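/- Let a, b, c ∈ ℝ and define, for measurable h : B_n → [0,∞], T_{a,b,c} h(z) = ∫_{B_n} (1−|z|²)^a (1−|w|²)^b (√△(w,z))^c |1−⟨z,w⟩|^{−(n+1+a+b+c)} h(w) dV(w). Then there exists a constant C with ∫_{B_n} (T_{a,b,c} h)² dλ_n ≤ C² ∫_{B_n} h² dλ_n for all measurable h : B_n → [0,∞] if and only if c > −2n and −2a < −n < 2(b+1). -/

import Mathlib

open MeasureTheory Metric Set Complex Topology
open scoped ENNReal NNReal

noncomputable section

/-- `ℂⁿ` with the Euclidean (Hermitian) norm: the ball `B_n` is `Metric.ball 0 1`. -/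
abbrev En (n : ℕ) : Type := EuclideanSpace ℂ (Fin n)

instance (n : ℕ) : MeasurableSpace (En n) := borel _
instance (n : ℕ) : BorelSpace (En n) := ⟨rfl⟩

/-- The Hilbert space `ℓ²` of square-summable complex sequences. -/
abbrev l2 : Type := lp (fun _ : ℕ => ℂ) 2

/-- The pairing `⟨z,w⟩ = ∑_j z_j conj (w_j)`. -/
def herm {n : ℕ} (z w : En n) : ℂ := ∑ j, z j * (starRingEnd ℂ) (w j)

/-- The Carleson tent `S_ζ`. -/
def tent {n : ℕ} (ζ : En n) : Set (En n) :=
  {z ∈ ball (0 : En n) 1 | 1 / 2 < (1 - ‖ζ‖) / ‖1 - herm z ζ‖}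

/-- The measure `λ_n` on `B_n`, `dλ_n(z) = (1-|z|²)^{-n-1} dV(z)`. -/
def lambdaM (n : ℕ) : Measure (En n) :=
  ((volume : Measure (En n)).restrict (ball (0 : En n) 1)).withDensity
    fun z => ENNReal.ofReal ((1 - ‖z‖ ^ 2) ^ (-(n : ℝ) - 1))

/-- The normalized rotation-invariant surface measure `σ` on the unit sphere `∂B_n`. -/
def sphereM (n : ℕ) : Measure (sphere (0 : En n) 1) :=
  (((volume : Measure (En n)).toSphere) Set.univ)⁻¹ • ((volume : Measure (En n)).toSphere)

/-- The squared Hilbert–Schmidt norm of the holomorphic derivative `f′(z) = (∂f_i/∂z_j)`. -/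
def hsSq {n : ℕ} (f : En n → l2) (z : En n) : ℝ :=
  ∑' i : ℕ, ∑ j, ‖(fderiv ℂ f z (EuclideanSpace.single j 1)) i‖ ^ 2

/-- The squared Carleson-measure norm `‖g‖_CM²` of a scalar function on the ball. -/
def cmSq {n : ℕ} (g : En n → ℝ) : ℝ≥0∞ :=
  ⨆ (ζ : En n) (_ : ζ ∈ ball (0 : En n) 1 \ {0}),
    (ENNReal.ofReal ((1 - ‖ζ‖) ^ n))⁻¹ *
      ∫⁻ z in tent ζ, ENNReal.ofReal ((g z) ^ 2) ∂(lambdaM n)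

/-- `△(w,z) = |1-⟨w,z⟩|² - (1-|w|²)(1-|z|²)`. -/
def trid {n : ℕ} (w z : En n) : ℝ :=
  ‖1 - herm w z‖ ^ 2 - (1 - ‖w‖ ^ 2) * (1 - ‖z‖ ^ 2)

/-- The positive operator `T_{a,b,c}` acting on nonnegative functions on the ball. -/
def Tabc {n : ℕ} (a b c : ℝ) (h : En n → ℝ≥0∞) (z : En n) : ℝ≥0∞ :=
  ∫⁻ w in ball (0 : En n) 1,
    ENNReal.ofReal
      ((1 - ‖z‖ ^ 2) ^ a * (1 - ‖w‖ ^ 2) ^ b * Real.sqrt (trid w z) ^ c *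
        ‖1 - herm z w‖ ^ (-((n : ℝ) + 1 + a + b + c))) * h w ∂volume

/-! ### One-dimensional integrals -/

lemma lint_Ioo_rpow {q R : ℝ} (hq : -1 < q) (hR : 0 ≤ R) :
    ∫⁻ x in Ioo 0 R, ENNReal.ofReal (x ^ q) = ENNReal.ofReal (R ^ (q + 1) / (q + 1)) := by
  have hintg : IntervalIntegrable (fun x : ℝ => x ^ q) volume 0 R :=
    intervalIntegral.intervalIntegrable_rpow' hq
  have h1 : IntegrableOn (fun x : ℝ => x ^ q) (Ioo 0 R) := by
    have := (intervalIntegrable_iff_integrableOn_Ioc_of_le hR).1 hintg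
    exact this.mono_set Ioo_subset_Ioc_self
  rw [← ofReal_integral_eq_lintegral_ofReal h1]
  · rw [← integral_Ioc_eq_integral_Ioo, ← intervalIntegral.integral_of_le hR,
      integral_rpow (Or.inl hq), Real.zero_rpow (by linarith), sub_zero]
  · filter_upwards [ae_restrict_mem measurableSet_Ioo] with x hx
    exact Real.rpow_nonneg hx.1.le _

lemma lint_Ioi_rpow {q R : ℝ} (hq : q < -1) (hR : 0 < R) :
    ∫⁻ x in Ioi R, ENNReal.ofReal (x ^ q) = ENNReal.ofReal (-R ^ (q + 1) / (q + 1)) := by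
  rw [← ofReal_integral_eq_lintegral_ofReal (integrableOn_Ioi_rpow_of_lt hq hR)]
  · rw [integral_Ioi_rpow_of_lt hq hR]
  · filter_upwards [ae_restrict_mem measurableSet_Ioi] with x hx
    exact Real.rpow_nonneg (hR.trans hx).le _

/-- Radial integration in the plane. -/
lemma lint_radial (f : ℝ → ℝ≥0∞) (hf : Measurable f) :
    ∫⁻ ζ : ℂ, f ‖ζ‖ = ENNReal.ofReal (2 * Real.pi) * ∫⁻ r in Ioi (0 : ℝ), ENNReal.ofReal r * f r := by
  rw [← Complex.lintegral_comp_polarCoord_symm]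
  have h : ∀ p ∈ polarCoord.target, ENNReal.ofReal p.1 • f ‖Complex.polarCoord.symm p‖
      = (ENNReal.ofReal p.1 * f p.1) := by
    intro p hp
    rw [Complex.norm_polarCoord_symm, abs_of_pos hp.1, smul_eq_mul]
  rw [setLIntegral_congr_fun polarCoord.open_target.measurableSet h, polarCoord_target,
    Measure.volume_eq_prod, ← Measure.prod_restrict,
    lintegral_prod _ (by fun_prop)]
  simp only [lintegral_const, Measure.restrict_apply, MeasurableSet.univ, univ_inter,
    Real.volume_Ioo]
  rw [lintegral_mul_const _ (by fun_prop), mul_comm]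
  congr 2
  ring

/-- Positive-part power. -/
def PP (q x : ℝ) : ℝ≥0∞ := if 0 < x then ENNReal.ofReal (x ^ q) else 0

lemma PP_pos {q x : ℝ} (hx : 0 < x) : PP q x = ENNReal.ofReal (x ^ q) := if_pos hx
lemma PP_neg {q x : ℝ} (hx : ¬ 0 < x) : PP q x = 0 := if_neg hx

@[fun_prop]
lemma measurable_PP (q : ℝ) : Measurable (PP q) := by
  unfold PP
  exact Measurable.ite measurableSet_Ioi (by fun_prop) measurable_const

lemma PP_add_le {q x : ℝ} {y : ℝ} (hx : 0 < x) (hxy : x ≤ y) (hy : y ≤ 2 * x) :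
    y ^ q ≤ 2 ^ |q| * x ^ q := by
  rcases le_total 0 q with h | h
  · calc y ^ q ≤ (2 * x) ^ q := Real.rpow_le_rpow (hx.le.trans hxy) hy h
      _ = 2 ^ q * x ^ q := Real.mul_rpow (by norm_num) hx.le
      _ = _ := by rw [abs_of_nonneg h]
  · calc y ^ q ≤ x ^ q := Real.rpow_le_rpow_of_nonpos hx hxy h
      _ = 1 * x ^ q := (one_mul _).symm
      _ ≤ _ := by
        gcongr
        exact Real.one_le_rpow (by norm_num) (abs_nonneg _)

lemma lint_reflect (f : ℝ → ℝ≥0∞) (R : ℝ) :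
    ∫⁻ x in Ioo 0 R, f (R - x) = ∫⁻ x in Ioo 0 R, f x := by
  have h := (Measure.measurePreserving_sub_left (volume : Measure ℝ) R)
  have h2 := h.setLIntegral_comp_emb (MeasurableEquiv.subLeft R).measurableEmbedding f (Ioo 0 R)
  simpa using h2

/-- One complex variable beta-type integral. -/
lemma lint_disc {q : ℝ} (hq : -1 < q) : ∃ C : ℝ≥0, ∀ R : ℝ,
    ∫⁻ ζ : ℂ, PP q (R - ‖ζ‖ ^ 2) ≤ C * PP (q + 1) R := by
  refine ⟨(2 * Real.pi * (2 ^ |q| / (q + 1))).toNNReal, fun R => ?_⟩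
  by_cases hR : 0 < R
  swap
  · have : ∀ ζ : ℂ, PP q (R - ‖ζ‖ ^ 2) = 0 := fun ζ => PP_neg (by nlinarith [sq_nonneg ‖ζ‖])
    simp [this]
  rw [lint_radial (fun r => PP q (R - r ^ 2)) (by fun_prop), PP_pos hR]
  set S := Real.sqrt R with hS
  have hS0 : 0 < S := Real.sqrt_pos.2 hR
  have hSR : S ^ 2 = R := Real.sq_sqrt hR.le
  have key : ∫⁻ r in Ioi (0 : ℝ), ENNReal.ofReal r * PP q (R - r ^ 2)
      ≤ ∫⁻ r in Ioo 0 S, ENNReal.ofReal (2 ^ |q| * S ^ (q + 1)) * ENNReal.ofReal ((S - r) ^ q) := by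
    rw [← lintegral_indicator measurableSet_Ioi, ← lintegral_indicator measurableSet_Ioo]
    apply lintegral_mono
    intro r
    by_cases hr : r ∈ Ioo 0 S
    · rw [indicator_of_mem hr, indicator_of_mem (show r ∈ Ioi 0 from hr.1)]
      have h1 : 0 < R - r ^ 2 := by nlinarith [hr.1, hr.2]
      rw [PP_pos h1, ← ENNReal.ofReal_mul hr.1.le, ← ENNReal.ofReal_mul (by positivity)]
      apply ENNReal.ofReal_le_ofReal
      have h2 : R - r ^ 2 = (S - r) * (S + r) := by rw [← hSR]; ring
      have h3 : (S + r) ^ q ≤ 2 ^ |q| * S ^ q := PP_add_le hS0 (by linarith [hr.1]) (by linarith [hr.2])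
      have h4 : 0 ≤ (S - r) ^ q := Real.rpow_nonneg (by linarith [hr.2]) _
      rw [h2, Real.mul_rpow (by linarith [hr.2]) (by linarith [hr.1]), Real.rpow_add hS0, Real.rpow_one]
      calc r * ((S - r) ^ q * (S + r) ^ q) ≤ S * ((S - r) ^ q * (2 ^ |q| * S ^ q)) := by
            have h5 : 0 ≤ (S + r) ^ q := Real.rpow_nonneg (by linarith [hr.1]) _
            have h6 : r ≤ S := hr.2.le
            gcongr
        _ = _ := by ring
    · rw [indicator_of_notMem hr]
      by_cases hr2 : r ∈ Ioi 0
      · rw [indicator_of_mem hr2, PP_neg, mul_zero]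
        have h5 : S ≤ r := by
          by_contra h
          exact hr ⟨hr2, not_le.1 h⟩
        nlinarith
      · rw [indicator_of_notMem hr2]
  calc _ ≤ ENNReal.ofReal (2 * Real.pi) * _ := mul_le_mul_right key _
    _ = ENNReal.ofReal (2 * Real.pi) * (ENNReal.ofReal (2 ^ |q| * S ^ (q + 1)) *
          ENNReal.ofReal (S ^ (q + 1) / (q + 1))) := by
        rw [lintegral_const_mul _ (by fun_prop), lint_reflect (fun x => ENNReal.ofReal (x ^ q)),
          lint_Ioo_rpow hq hS0.le]
    _ = ENNReal.ofReal ((2 * Real.pi * (2 ^ |q| / (q + 1)))) * ENNReal.ofReal (R ^ (q + 1)) := by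
        have : R ^ (q + 1) = S ^ (q + 1) * S ^ (q + 1) := by
          rw [← hSR, sq, Real.mul_rpow hS0.le hS0.le]
        have hq1 : 0 < q + 1 := by linarith
        rw [← ENNReal.ofReal_mul (by positivity), ← ENNReal.ofReal_mul (by positivity),
          ← ENNReal.ofReal_mul (by positivity), this]
        congr 1
        ring
    _ ≤ _ := le_rfl

/-- Splitting off the first coordinate of `Fin (m+1) → ℂ`. -/
lemma lint_pi_succ (m : ℕ) (F : ℂ → (Fin m → ℂ) → ℝ≥0∞)
    (hF : Measurable (fun p : ℂ × (Fin m → ℂ) => F p.1 p.2)) :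
    ∫⁻ w : Fin (m + 1) → ℂ, F (w 0) (fun j => w j.succ) = ∫⁻ ζ : ℂ, ∫⁻ w : Fin m → ℂ, F ζ w := by
  have h := (volume_preserving_piFinSuccAbove (fun _ : Fin (m + 1) => ℂ) 0).lintegral_comp hF
  rw [Measure.volume_eq_prod, lintegral_prod _ hF.aemeasurable] at h
  rw [← h]
  rfl

lemma lint_ball_coord {t : ℝ} (ht : -1 < t) (m : ℕ) : ∃ C : ℝ≥0, ∀ R : ℝ,
    ∫⁻ w : Fin m → ℂ, PP t (R - ∑ j, ‖w j‖ ^ 2) ≤ C * PP (t + m) R := by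
  induction m with
  | zero => exact ⟨1, fun R => by simp [volume_pi]⟩
  | succ m ih =>
    obtain ⟨C, hC⟩ := ih
    obtain ⟨D, hD⟩ := lint_disc (q := t + m) (by linarith [(Nat.cast_nonneg m : (0 : ℝ) ≤ m)])
    refine ⟨C * D, fun R => ?_⟩
    have h1 := lint_pi_succ m (fun ζ w => PP t (R - (‖ζ‖ ^ 2 + ∑ j, ‖w j‖ ^ 2))) (by fun_prop)
    simp only [Fin.sum_univ_succ]
    rw [h1]
    calc _ ≤ ∫⁻ ζ : ℂ, C * PP (t + m) (R - ‖ζ‖ ^ 2) := by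
          apply lintegral_mono
          intro ζ
          simp only [← sub_sub]
          exact hC _
      _ = C * ∫⁻ ζ : ℂ, PP (t + m) (R - ‖ζ‖ ^ 2) := lintegral_const_mul _ (by fun_prop)
      _ ≤ C * (D * PP (t + m + 1) R) := by gcongr; exact hD R
      _ = _ := by
        push_cast
        rw [mul_assoc, add_assoc]

/-- Product integrals over `Fin m → ℂ`. -/
lemma lint_pi_prod (m : ℕ) (f : ℂ → ℝ≥0∞) (hf : Measurable f) :
    ∫⁻ w : Fin m → ℂ, ∏ j, f (w j) = (∫⁻ ζ, f ζ) ^ m := by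
  induction m with
  | zero => simp [volume_pi]
  | succ m ih =>
    have h1 := lint_pi_succ m (fun ζ w => f ζ * ∏ j, f (w j)) (by fun_prop)
    simp only [Fin.prod_univ_succ]
    rw [h1]
    have : ∀ ζ : ℂ, ∫⁻ w : Fin m → ℂ, f ζ * ∏ j, f (w j) = f ζ * (∫⁻ ζ, f ζ) ^ m := by
      intro ζ
      rw [lintegral_const_mul _ (by fun_prop), ih]
    simp only [this]
    rw [lintegral_mul_const _ hf, pow_succ, mul_comm]


/-! ### The disc estimate -/

lemma lint_angular {p D : ℝ} (hp : 1 < p) (hD : 0 < D) :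
    ∫⁻ θ : ℝ, ENNReal.ofReal ((D + |θ|) ^ (-p)) ≤ ENNReal.ofReal (2 / (p - 1) * D ^ (1 - p)) := by
  set G : ℝ → ℝ≥0∞ := (Ici D).indicator (fun x => ENNReal.ofReal (x ^ (-p))) with hG
  have hGm : Measurable G := Measurable.indicator (by fun_prop) measurableSet_Ici
  have hGi : ∫⁻ x, G x = ENNReal.ofReal (1 / (p - 1) * D ^ (1 - p)) := by
    rw [hG, lintegral_indicator measurableSet_Ici, ← setLIntegral_congr Ioi_ae_eq_Ici,
      lint_Ioi_rpow (by linarith) hD]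
    congr 1
    rw [show -p + 1 = -(p - 1) by ring, show 1 - p = -(p - 1) by ring, neg_div_neg_eq]
    ring
  calc _ ≤ ∫⁻ θ : ℝ, (G (D + θ) + G (D - θ)) := by
        apply lintegral_mono
        intro θ
        simp only
        rcases le_total 0 θ with h | h
        · refine le_trans ?_ le_self_add
          rw [hG, indicator_of_mem (show D + θ ∈ Ici D by simpa using h), abs_of_nonneg h]
        · refine le_trans ?_ le_add_self
          rw [hG, indicator_of_mem (show D - θ ∈ Ici D by simpa using h), abs_of_nonpos h, sub_eq_add_neg]
    _ = (∫⁻ x, G x) + ∫⁻ x, G x := by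
        rw [lintegral_add_left (by fun_prop), lintegral_add_left_eq_self G D,
          lintegral_sub_left_eq_self G D]
    _ = _ := by
        have : 0 < p - 1 := by linarith
        rw [hGi, ← ENNReal.ofReal_add (by positivity) (by positivity)]
        congr 1
        ring

lemma lint_rad {τ s δ : ℝ} (hτ : -1 < τ) (hs : 0 < s) (hδ : 0 < δ) :
    ∫⁻ x in Ioo (0 : ℝ) 1, ENNReal.ofReal (x ^ τ * (δ + x) ^ (-(1 + τ + s)))
      ≤ ENNReal.ofReal ((1 / (τ + 1) + 1 / s) * δ ^ (-s)) := by
  have hτ1 : 0 < τ + 1 := by linarith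
  set f : ℝ → ℝ≥0∞ := fun x => ENNReal.ofReal (x ^ τ * (δ + x) ^ (-(1 + τ + s))) with hf
  have hsub : Ioo (0 : ℝ) 1 ⊆ Ioo 0 δ ∪ Ici δ := by
    intro x hx
    rcases lt_or_ge x δ with h | h
    · exact Or.inl ⟨hx.1, h⟩
    · exact Or.inr h
  have hA : ∫⁻ x in Ioo 0 δ, f x ≤ ENNReal.ofReal (1 / (τ + 1) * δ ^ (-s)) := by
    calc _ ≤ ∫⁻ x in Ioo 0 δ, ENNReal.ofReal (δ ^ (-(1 + τ + s))) * ENNReal.ofReal (x ^ τ) := by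
          apply setLIntegral_mono' measurableSet_Ioo
          intro x hx
          have hx1 : 0 < x := hx.1
          rw [hf, ← ENNReal.ofReal_mul (by positivity)]
          apply ENNReal.ofReal_le_ofReal
          rw [mul_comm]
          exact mul_le_mul_of_nonneg_right
            (Real.rpow_le_rpow_of_nonpos hδ (by linarith) (by linarith)) (by positivity)
      _ = _ := by
          rw [lintegral_const_mul _ (by fun_prop), lint_Ioo_rpow hτ hδ.le,
            ← ENNReal.ofReal_mul (by positivity)]
          congr 1
          have : δ ^ (-s) = δ ^ (-(1 + τ + s)) * δ ^ (τ + 1) := by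
            rw [← Real.rpow_add hδ]
            congr 1
            ring
          rw [this]
          ring
  have hB : ∫⁻ x in Ici δ, f x ≤ ENNReal.ofReal (1 / s * δ ^ (-s)) := by
    calc _ ≤ ∫⁻ x in Ici δ, ENNReal.ofReal (x ^ (-1 - s)) := by
          apply setLIntegral_mono' measurableSet_Ici
          intro x hx
          have hx1 : 0 < x := hδ.trans_le hx
          apply ENNReal.ofReal_le_ofReal
          rw [show -1 - s = τ + -(1 + τ + s) by ring, Real.rpow_add hx1]
          exact mul_le_mul_of_nonneg_left
            (Real.rpow_le_rpow_of_nonpos hx1 (by linarith) (by linarith)) (by positivity)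
      _ = _ := by
          rw [← setLIntegral_congr Ioi_ae_eq_Ici, lint_Ioi_rpow (by linarith) hδ]
          congr 1
          rw [show -1 - s + 1 = -s by ring, neg_div_neg_eq]
          ring
  calc _ ≤ ∫⁻ x in Ioo 0 δ ∪ Ici δ, f x := lintegral_mono_set hsub
    _ ≤ _ := lintegral_union_le _ _ _
    _ ≤ _ := add_le_add hA hB
    _ = _ := by
      rw [← ENNReal.ofReal_add (by positivity) (by positivity)]
      congr 1
      ring

lemma norm_one_sub_polar {s θ : ℝ} (hs0 : 0 ≤ s) (hs : s < 1) (hθ : |θ| ≤ Real.pi) :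
    ((1 - s) + |θ|) / 6 ≤ ‖1 - (s : ℂ) * Complex.exp (θ * Complex.I)‖ := by
  set e := Complex.exp (θ * Complex.I) with he
  have hne : ‖e‖ = 1 := Complex.norm_exp_ofReal_mul_I θ
  set N := ‖1 - (s : ℂ) * e‖ with hN
  have h1 : 1 - s ≤ N := by
    have := norm_sub_norm_le (1 : ℂ) ((s : ℂ) * e)
    simpa [hne, abs_of_nonneg hs0] using this
  have h2 : ‖1 - e‖ ≤ N + (1 - s) := by
    have h : 1 - e = (1 - (s : ℂ) * e) + ((s - 1 : ℝ) : ℂ) * e := by push_cast; ring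
    calc ‖1 - e‖ ≤ N + ‖((s - 1 : ℝ) : ℂ) * e‖ := by rw [h]; exact norm_add_le _ _
      _ = _ := by rw [norm_mul, hne, Complex.norm_real, mul_one, Real.norm_eq_abs,
                    abs_of_neg (by linarith)]; ring
  have h3 : 2 / Real.pi * |θ| ≤ ‖1 - e‖ := by
    have h : ‖1 - e‖ = ‖2 * Real.sin (θ / 2)‖ := by
      rw [norm_sub_rev, he, mul_comm, Complex.norm_exp_I_mul_ofReal_sub_one]
    rw [h, norm_mul, Real.norm_eq_abs, Real.norm_eq_abs, abs_two]
    have := Real.mul_abs_le_abs_sin (x := θ / 2) (by rw [abs_div, abs_two]; linarith)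
    rw [abs_div, abs_two] at this
    have h5 : 2 / Real.pi * |θ| = 2 * (2 / Real.pi * (|θ| / 2)) := by ring
    rw [h5]
    linarith
  have h4 : |θ| / 2 ≤ 2 / Real.pi * |θ| := by
    have : (1 : ℝ) / 2 ≤ 2 / Real.pi := by
      rw [div_le_div_iff₀ (by norm_num) Real.pi_pos]
      linarith [Real.pi_le_four]
    nlinarith [abs_nonneg θ]
  linarith [abs_nonneg θ]

/-- Forelli–Rudin type estimate on the disc. -/
lemma lint_FR_disc {τ s : ℝ} (hτ : -1 < τ) (hs : 0 < s) : ∃ C : ℝ≥0, ∀ r : ℝ, 0 ≤ r → r < 1 →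
    ∫⁻ ζ : ℂ, PP τ (1 - ‖ζ‖ ^ 2) * ENNReal.ofReal (‖1 - (r : ℂ) * ζ‖ ^ (-(2 + τ + s)))
      ≤ C * ENNReal.ofReal ((1 - r ^ 2) ^ (-s)) := by
  set p := 2 + τ + s with hp
  have hp1 : 0 < p - 1 := by rw [hp]; linarith
  have hτ1 : 0 < τ + 1 := by linarith
  set K1 : ℝ := 2 ^ |τ| * 12 ^ p * (2 / (p - 1)) with hK1
  have hK1p : 0 ≤ K1 := by positivity
  refine ⟨(K1 * ((1 / (τ + 1) + 1 / s) * 2 ^ s)).toNNReal, fun r hr0 hr1 => ?_⟩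
  set δ := 1 - r with hδ
  have hδ0 : 0 < δ := by rw [hδ]; linarith
  rw [← Complex.lintegral_comp_polarCoord_symm, polarCoord_target,
    Measure.volume_eq_prod, ← Measure.prod_restrict]
  have hmeas : Measurable (fun p_1 : ℝ × ℝ => ENNReal.ofReal p_1.1 •
      (PP τ (1 - ‖Complex.polarCoord.symm p_1‖ ^ 2) *
        ENNReal.ofReal (‖1 - (r : ℂ) * Complex.polarCoord.symm p_1‖ ^ (-p)))) := by
    have : Measurable (fun x : ℝ × ℝ => (Complex.polarCoord.symm x : ℂ)) := by
      have : (fun x : ℝ × ℝ => (Complex.polarCoord.symm x : ℂ))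
          = fun x : ℝ × ℝ => (x.1 : ℂ) * (Real.cos x.2 + Real.sin x.2 * Complex.I) := by
        ext x; exact Complex.polarCoord_symm_apply x
      rw [this]
      fun_prop
    simp only [smul_eq_mul]
    fun_prop
  rw [lintegral_prod _ hmeas.aemeasurable]
  have hinner : ∀ ρ ∈ Ioi (0 : ℝ), ∫⁻ θ in Ioo (-Real.pi) Real.pi, ENNReal.ofReal ρ •
      (PP τ (1 - ‖Complex.polarCoord.symm (ρ, θ)‖ ^ 2) *
        ENNReal.ofReal (‖1 - (r : ℂ) * Complex.polarCoord.symm (ρ, θ)‖ ^ (-p)))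
      ≤ (Ioo 0 1).indicator (fun ρ => ENNReal.ofReal K1 * ENNReal.ofReal ((1 - ρ) ^ τ * (δ + (1 - ρ)) ^ (-(1 + τ + s)))) ρ := by
    intro ρ hρ
    have hρ0 : 0 < ρ := hρ
    simp only [Complex.norm_polarCoord_symm, abs_of_pos hρ0, smul_eq_mul]
    by_cases hρ1 : ρ < 1
    swap
    · have h0 : ¬ 0 < 1 - ρ ^ 2 := by nlinarith
      simp [PP_neg h0]
    rw [indicator_of_mem (show ρ ∈ Ioo 0 1 from ⟨hρ0, hρ1⟩)]
    have h0 : 0 < 1 - ρ ^ 2 := by nlinarith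
    have hx : 0 < 1 - ρ := by linarith
    rw [PP_pos h0]
    have hD : 0 < δ + (1 - ρ) := by linarith
    calc _ ≤ ∫⁻ θ in Ioo (-Real.pi) Real.pi, ENNReal.ofReal (2 ^ |τ| * (1 - ρ) ^ τ * 12 ^ p) *
            ENNReal.ofReal ((δ + (1 - ρ) + |θ|) ^ (-p)) := by
          apply setLIntegral_mono' measurableSet_Ioo
          intro θ hθ
          rw [← ENNReal.ofReal_mul (by positivity), ← ENNReal.ofReal_mul (by positivity),
            ← ENNReal.ofReal_mul (by positivity)]
          apply ENNReal.ofReal_le_ofReal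
          have e1 : (1 - ρ ^ 2) ^ τ ≤ 2 ^ |τ| * (1 - ρ) ^ τ :=
            PP_add_le hx (by nlinarith) (by nlinarith)
          have e2 : (1 - (r : ℂ) * Complex.polarCoord.symm (ρ, θ)) =
              1 - ((r * ρ : ℝ) : ℂ) * Complex.exp (θ * Complex.I) := by
            rw [Complex.polarCoord_symm_apply, Complex.exp_mul_I]
            push_cast
            ring
          have e3 : (δ + (1 - ρ) + |θ|) / 12 ≤ ‖1 - (r : ℂ) * Complex.polarCoord.symm (ρ, θ)‖ := by
            rw [e2]
            refine le_trans ?_ (norm_one_sub_polar (by positivity) (by nlinarith)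
              (abs_le.2 ⟨hθ.1.le, hθ.2.le⟩))
            have : δ + (1 - ρ) ≤ 2 * (1 - r * ρ) := by rw [hδ]; nlinarith
            linarith [abs_nonneg θ]
          have hDθ : 0 < δ + (1 - ρ) + |θ| := by positivity
          have e4 : ‖1 - (r : ℂ) * Complex.polarCoord.symm (ρ, θ)‖ ^ (-p) ≤
              12 ^ p * (δ + (1 - ρ) + |θ|) ^ (-p) := by
            calc _ ≤ ((δ + (1 - ρ) + |θ|) / 12) ^ (-p) :=
                  Real.rpow_le_rpow_of_nonpos (by positivity) e3 (by linarith)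
              _ = _ := by
                  rw [Real.div_rpow hDθ.le (by norm_num), Real.rpow_neg (by norm_num : (0 : ℝ) ≤ 12)]
                  field_simp
          calc _ ≤ 1 * ((2 ^ |τ| * (1 - ρ) ^ τ) * (12 ^ p * (δ + (1 - ρ) + |θ|) ^ (-p))) := by
                gcongr
            _ = _ := by ring
      _ ≤ ENNReal.ofReal (2 ^ |τ| * (1 - ρ) ^ τ * 12 ^ p) *
            ENNReal.ofReal (2 / (p - 1) * (δ + (1 - ρ)) ^ (1 - p)) := by
          rw [lintegral_const_mul _ (by fun_prop)]
          gcongr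
          exact (setLIntegral_le_lintegral _ _).trans (lint_angular (by linarith) hD)
      _ = _ := by
          rw [← ENNReal.ofReal_mul (by positivity), ← ENNReal.ofReal_mul (by positivity)]
          congr 1
          rw [show 1 - p = -(1 + τ + s) by rw [hp]; ring, hK1]
          ring
  calc _ ≤ ∫⁻ ρ in Ioi (0 : ℝ), (Ioo 0 1).indicator (fun ρ => ENNReal.ofReal K1 *
            ENNReal.ofReal ((1 - ρ) ^ τ * (δ + (1 - ρ)) ^ (-(1 + τ + s)))) ρ :=
        setLIntegral_mono' measurableSet_Ioi hinner
    _ ≤ ∫⁻ ρ, (Ioo 0 1).indicator (fun ρ => ENNReal.ofReal K1 *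
            ENNReal.ofReal ((1 - ρ) ^ τ * (δ + (1 - ρ)) ^ (-(1 + τ + s)))) ρ :=
        setLIntegral_le_lintegral _ _
    _ = ENNReal.ofReal K1 * ∫⁻ ρ in Ioo 0 1,
            ENNReal.ofReal ((1 - ρ) ^ τ * (δ + (1 - ρ)) ^ (-(1 + τ + s))) := by
        rw [lintegral_indicator measurableSet_Ioo, lintegral_const_mul _ (by fun_prop)]
    _ ≤ ENNReal.ofReal K1 * ENNReal.ofReal ((1 / (τ + 1) + 1 / s) * δ ^ (-s)) := by
        gcongr
        rw [lint_reflect (fun x => ENNReal.ofReal (x ^ τ * (δ + x) ^ (-(1 + τ + s))))]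
        exact lint_rad hτ hs hδ0
    _ ≤ ENNReal.ofReal (K1 * ((1 / (τ + 1) + 1 / s) * 2 ^ s)) * ENNReal.ofReal ((1 - r ^ 2) ^ (-s)) := by
        rw [← ENNReal.ofReal_mul hK1p, ← ENNReal.ofReal_mul (by positivity)]
        apply ENNReal.ofReal_le_ofReal
        have h1 : 0 < 1 - r ^ 2 := by nlinarith
        have : δ ^ (-s) ≤ 2 ^ s * (1 - r ^ 2) ^ (-s) := by
          calc δ ^ (-s) ≤ ((1 - r ^ 2) / 2) ^ (-s) :=
                Real.rpow_le_rpow_of_nonpos (by positivity) (by rw [hδ]; nlinarith) (by linarith)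
            _ = _ := by
                rw [Real.div_rpow h1.le (by norm_num), Real.rpow_neg (by norm_num : (0 : ℝ) ≤ 2)]
                field_simp
        calc _ ≤ K1 * ((1 / (τ + 1) + 1 / s) * (2 ^ s * (1 - r ^ 2) ^ (-s))) := by gcongr
          _ = _ := by ring
    _ ≤ _ := le_rfl


/-! ### Geometry -/

lemma herm_eq_inner {n : ℕ} (z w : En n) : herm z w = inner ℂ w z := by
  simp [herm, PiLp.inner_apply]

lemma herm_conj {n : ℕ} (z w : En n) : herm z w = (starRingEnd ℂ) (herm w z) := by
  rw [herm_eq_inner, herm_eq_inner, inner_conj_symm]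

lemma norm_one_sub_herm_comm {n : ℕ} (z w : En n) : ‖1 - herm z w‖ = ‖1 - herm w z‖ := by
  rw [herm_conj z w, ← Complex.norm_conj (1 - herm w z)]
  simp

lemma norm_herm_le {n : ℕ} (z w : En n) : ‖herm z w‖ ≤ ‖z‖ * ‖w‖ := by
  rw [herm_eq_inner, mul_comm]
  exact norm_inner_le_norm w z

lemma trid_comm {n : ℕ} (z w : En n) : trid z w = trid w z := by
  unfold trid
  rw [norm_one_sub_herm_comm]
  ring

lemma trid_formula {n : ℕ} (w z : En n) :
    trid w z = (1 - ‖z‖ ^ 2) * ‖w - z‖ ^ 2 + ‖herm (w - z) z‖ ^ 2 := by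
  have h1 : herm (w - z) z = herm w z - ((‖z‖ ^ 2 : ℝ) : ℂ) := by
    simp only [herm_eq_inner, inner_sub_right, inner_self_eq_norm_sq_to_K]
    push_cast
    rfl
  have h2 : ‖w - z‖ ^ 2 = ‖w‖ ^ 2 - 2 * (herm w z).re + ‖z‖ ^ 2 := by
    rw [@norm_sub_sq ℂ]
    have h := inner_re_symm (𝕜 := ℂ) w z
    simp only [RCLike.re_eq_complex_re] at h ⊢
    rw [herm_eq_inner, h]
  rw [h1, h2, trid, ← Complex.normSq_eq_norm_sq, ← Complex.normSq_eq_norm_sq]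
  simp only [Complex.normSq_apply, Complex.sub_re, Complex.sub_im, Complex.one_re, Complex.one_im,
    Complex.ofReal_re, Complex.ofReal_im]
  ring

lemma continuous_herm {n : ℕ} : Continuous (fun p : En n × En n => herm p.1 p.2) := by
  simp only [herm_eq_inner]
  fun_prop

lemma continuous_trid {n : ℕ} : Continuous (fun p : En n × En n => trid p.1 p.2) := by
  unfold trid
  have := continuous_herm (n := n)
  fun_prop

lemma one_sub_pos {n : ℕ} {z : En n} (hz : z ∈ ball (0 : En n) 1) : 0 < 1 - ‖z‖ ^ 2 := by
  rw [mem_ball_zero_iff] at hz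
  nlinarith [norm_nonneg z]

lemma half_le_E {n : ℕ} {z w : En n} (hz : z ∈ ball (0 : En n) 1) (hw : w ∈ ball (0 : En n) 1) :
    (1 - ‖z‖ ^ 2) / 2 ≤ ‖1 - herm z w‖ := by
  rw [mem_ball_zero_iff] at hz hw
  have h1 := norm_sub_norm_le (1 : ℂ) (herm z w)
  rw [norm_one] at h1
  have h2 := norm_herm_le z w
  nlinarith [norm_nonneg z, norm_nonneg w]

lemma half_le_E' {n : ℕ} {z w : En n} (hz : z ∈ ball (0 : En n) 1) (hw : w ∈ ball (0 : En n) 1) :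
    (1 - ‖w‖ ^ 2) / 2 ≤ ‖1 - herm z w‖ := by
  rw [norm_one_sub_herm_comm]
  exact half_le_E hw hz

lemma E_pos {n : ℕ} {z w : En n} (hz : z ∈ ball (0 : En n) 1) (hw : w ∈ ball (0 : En n) 1) :
    0 < ‖1 - herm z w‖ := lt_of_lt_of_le (by linarith [one_sub_pos hz]) (half_le_E hz hw)

lemma volume_coord (n : ℕ) : ∃ κ : ℝ≥0, ∀ f : En n → ℝ≥0∞, Measurable f →
    ∫⁻ w, f w = κ * ∫⁻ w : Fin n → ℂ, f (WithLp.toLp 2 w) := by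
  let e : (Fin n → ℂ) ≃L[ℝ] En n := (PiLp.continuousLinearEquiv 2 ℝ (fun _ : Fin n => ℂ)).symm
  have hH : (Measure.map e (volume : Measure (Fin n → ℂ))).IsAddHaarMeasure :=
    e.isAddHaarMeasure_map _
  have h := Measure.isAddLeftInvariant_eq_smul (volume : Measure (En n))
    (Measure.map e (volume : Measure (Fin n → ℂ)))
  refine ⟨(volume : Measure (En n)).addHaarScalarFactor
    (Measure.map e (volume : Measure (Fin n → ℂ))), fun f hf => ?_⟩
  conv_lhs => rw [h]
  rw [lintegral_smul_measure, lintegral_map hf e.continuous.measurable]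
  rfl

lemma exists_rot {m : ℕ} (z : En (m + 1)) : ∃ L : En (m + 1) ≃ₗᵢ[ℂ] En (m + 1),
    L z = WithLp.toLp 2 (Pi.single 0 (‖z‖ : ℂ)) := by
  by_cases hz : z = 0
  · refine ⟨LinearIsometryEquiv.refl ℂ _, ?_⟩
    subst hz
    simp
  have hz' : ‖z‖ ≠ 0 := norm_ne_zero_iff.2 hz
  let v : Fin (m + 1) → En (m + 1) := fun _ => ((‖z‖ : ℂ)⁻¹) • z
  have hv : Orthonormal ℂ (({0} : Set (Fin (m + 1))).domRestrict v) := by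
    constructor
    · intro i
      simp [v, norm_smul, hz']
    · intro i j hij
      exact absurd (Subsingleton.elim i j) hij
  obtain ⟨b, hb⟩ := hv.exists_orthonormalBasis_extension_of_card_eq (by simp)
  refine ⟨b.repr, ?_⟩
  have h0 : b 0 = ((‖z‖ : ℂ)⁻¹) • z := hb 0 rfl
  have h1 : z = (‖z‖ : ℂ) • b 0 := by
    rw [h0, smul_smul, mul_inv_cancel₀ (by exact_mod_cast hz'), one_smul]
  conv_lhs => rw [h1]
  rw [map_smul, b.repr_self]
  ext i
  by_cases hi : i = 0
  · subst hi; simp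
  · simp [hi]

lemma lint_rot {n : ℕ} (L : En n ≃ₗᵢ[ℂ] En n) (f : En n → ℝ≥0∞) :
    ∫⁻ w, f (L w) = ∫⁻ w, f w := by
  let L' : En n ≃ₗᵢ[ℝ] En n := ⟨L.toLinearEquiv.restrictScalars ℝ, L.norm_map⟩
  exact L'.measurePreserving.lintegral_comp_emb L'.toHomeomorph.measurableEmbedding f

/-- Reduction to coordinates. -/
lemma lint_coord (m : ℕ) : ∃ κ : ℝ≥0, ∀ (z : En (m + 1)) (G : ℝ → ℂ → ℝ≥0∞),
    Measurable (fun p : ℝ × ℂ => G p.1 p.2) →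
    ∫⁻ w, G (‖w‖ ^ 2) (herm z w) = κ * ∫⁻ ζ : ℂ, ∫⁻ w : Fin m → ℂ,
      G (‖ζ‖ ^ 2 + ∑ j, ‖w j‖ ^ 2) (‖z‖ * (starRingEnd ℂ) ζ) := by
  obtain ⟨κ, hκ⟩ := volume_coord (m + 1)
  refine ⟨κ, fun z G hG => ?_⟩
  obtain ⟨L, hL⟩ := exists_rot z
  have h1 : ∀ w, G (‖w‖ ^ 2) (herm z w) =
      (fun w => G (‖w‖ ^ 2) (herm (WithLp.toLp 2 (Pi.single 0 (‖z‖ : ℂ)) : En (m + 1)) w)) (L w) := by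
    intro w
    simp only [← hL, herm_eq_inner, L.norm_map, L.inner_map_map]
  simp_rw [h1]
  rw [lint_rot L (fun w => G (‖w‖ ^ 2) (herm (WithLp.toLp 2 (Pi.single 0 (‖z‖ : ℂ)) : En (m + 1)) w)), hκ]
  · congr 1
    have hF : Measurable (fun p : ℂ × (Fin m → ℂ) =>
        G (‖p.1‖ ^ 2 + ∑ j, ‖p.2 j‖ ^ 2) (‖z‖ * (starRingEnd ℂ) p.1)) := by
      have : Measurable (fun p : ℂ × (Fin m → ℂ) =>
        ((‖p.1‖ ^ 2 + ∑ j, ‖p.2 j‖ ^ 2 : ℝ), (‖z‖ * (starRingEnd ℂ) p.1 : ℂ))) := by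
        have := Complex.continuous_conj.measurable
        fun_prop
      exact hG.comp this
    rw [← lint_pi_succ m (fun ζ w => G (‖ζ‖ ^ 2 + ∑ j, ‖w j‖ ^ 2) (‖z‖ * (starRingEnd ℂ) ζ)) hF]
    apply lintegral_congr
    intro w
    congr 1
    · rw [EuclideanSpace.norm_sq_eq, Fin.sum_univ_succ]
    · simp [herm, Fin.sum_univ_succ]
  · have : Measurable (fun w : En (m + 1) =>
        (‖w‖ ^ 2, herm (WithLp.toLp 2 (Pi.single 0 (‖z‖ : ℂ)) : En (m + 1)) w)) := by
      have := (continuous_herm (n := m + 1)).comp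
        (Continuous.prodMk_right (WithLp.toLp 2 (Pi.single 0 (‖z‖ : ℂ)) : En (m + 1)))
      have h2 := this.measurable
      simp only [Function.comp_def] at h2
      exact (by fun_prop : Measurable (fun w : En (m+1) => ‖w‖ ^ 2)).prodMk h2
    exact hG.comp this


/-! ### Forelli–Rudin estimate on the ball and the local singular integral -/

lemma lint_FR_ball (m : ℕ) {t s : ℝ} (ht : -1 < t) (hs : 0 < s) : ∃ C : ℝ≥0,
    ∀ z ∈ ball (0 : En (m + 1)) 1,
    ∫⁻ w : En (m + 1), PP t (1 - ‖w‖ ^ 2) *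
        ENNReal.ofReal (‖1 - herm z w‖ ^ (-(((m + 1 : ℕ) : ℝ) + 1 + t + s)))
      ≤ C * ENNReal.ofReal ((1 - ‖z‖ ^ 2) ^ (-s)) := by
  obtain ⟨κ, hκ⟩ := lint_coord m
  obtain ⟨C1, hC1⟩ := lint_ball_coord ht m
  have hm : (0 : ℝ) ≤ m := Nat.cast_nonneg m
  obtain ⟨C2, hC2⟩ := lint_FR_disc (τ := t + m) (s := s) (by linarith) hs
  refine ⟨κ * (C1 * C2), fun z hz => ?_⟩
  set p := ((m + 1 : ℕ) : ℝ) + 1 + t + s with hp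
  rw [hκ z (fun R u => PP t (1 - R) * ENNReal.ofReal (‖1 - u‖ ^ (-p))) (by fun_prop)]
  have hz1 : ‖z‖ < 1 := mem_ball_zero_iff.1 hz
  have hin : ∀ ζ : ℂ, ∫⁻ w : Fin m → ℂ, PP t (1 - (‖ζ‖ ^ 2 + ∑ j, ‖w j‖ ^ 2)) *
      ENNReal.ofReal (‖1 - (‖z‖ : ℂ) * (starRingEnd ℂ) ζ‖ ^ (-p))
      ≤ C1 * (PP (t + m) (1 - ‖ζ‖ ^ 2) * ENNReal.ofReal (‖1 - (‖z‖ : ℂ) * ζ‖ ^ (-(2 + (t + m) + s)))) := by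
    intro ζ
    rw [lintegral_mul_const _ (by fun_prop), ← mul_assoc]
    have e1 : ‖1 - (‖z‖ : ℂ) * (starRingEnd ℂ) ζ‖ = ‖1 - (‖z‖ : ℂ) * ζ‖ := by
      rw [← Complex.norm_conj]
      simp
    have e2 : p = 2 + (t + m) + s := by rw [hp]; push_cast; ring
    rw [e1, e2]
    gcongr
    simp only [← sub_sub]
    exact hC1 _
  calc _ ≤ (κ : ℝ≥0∞) * ∫⁻ ζ : ℂ, C1 * (PP (t + m) (1 - ‖ζ‖ ^ 2) *
          ENNReal.ofReal (‖1 - (‖z‖ : ℂ) * ζ‖ ^ (-(2 + (t + m) + s)))) := by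
        gcongr with ζ
        exact hin ζ
    _ = κ * (C1 * ∫⁻ ζ : ℂ, (PP (t + m) (1 - ‖ζ‖ ^ 2) *
          ENNReal.ofReal (‖1 - (‖z‖ : ℂ) * ζ‖ ^ (-(2 + (t + m) + s))))) := by
        rw [lintegral_const_mul _ (by fun_prop)]
    _ ≤ κ * (C1 * (C2 * ENNReal.ofReal ((1 - ‖z‖ ^ 2) ^ (-s)))) := by
        gcongr
        exact hC2 _ (norm_nonneg z) hz1
    _ = _ := by
        push_cast
        ring

/-- Truncated negative power. -/
def QQ (γ A y : ℝ) : ℝ≥0∞ := if y ≤ A then (ENNReal.ofReal y) ^ γ else 0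

@[fun_prop]
lemma measurable_QQ (γ A : ℝ) : Measurable (QQ γ A) := by
  unfold QQ
  exact Measurable.ite measurableSet_Iic (by fun_prop) measurable_const

lemma lint_QQ {γ A k : ℝ} (hγ : -2 < γ) (hA : 0 ≤ A) (hk : 0 < k) :
    ∫⁻ ζ : ℂ, QQ γ A (k * ‖ζ‖) ≤ ENNReal.ofReal (2 * Real.pi / (γ + 2) * (k ^ γ * (A / k) ^ (γ + 2))) := by
  have hγ2 : 0 < γ + 2 := by linarith
  rw [lint_radial (fun r => QQ γ A (k * r)) (by fun_prop)]
  have key : ∫⁻ r in Ioi (0 : ℝ), ENNReal.ofReal r * QQ γ A (k * r)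
      ≤ ∫⁻ r in Ioc 0 (A / k), ENNReal.ofReal (k ^ γ) * ENNReal.ofReal (r ^ (γ + 1)) := by
    rw [← lintegral_indicator measurableSet_Ioi, ← lintegral_indicator measurableSet_Ioc]
    apply lintegral_mono
    intro r
    by_cases hr : r ∈ Ioc 0 (A / k)
    · rw [indicator_of_mem hr, indicator_of_mem (show r ∈ Ioi 0 from hr.1)]
      have hr0 : 0 < r := hr.1
      have h1 : k * r ≤ A := by
        have := (le_div_iff₀ hk).1 hr.2
        linarith
      rw [QQ, if_pos h1, ENNReal.ofReal_rpow_of_pos (by positivity),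
        ← ENNReal.ofReal_mul hr0.le, ← ENNReal.ofReal_mul (by positivity)]
      apply ENNReal.ofReal_le_ofReal
      rw [Real.mul_rpow hk.le hr0.le, Real.rpow_add hr0, Real.rpow_one]
      apply le_of_eq
      ring
    · rw [indicator_of_notMem hr]
      by_cases hr2 : r ∈ Ioi 0
      · rw [indicator_of_mem hr2, QQ, if_neg, mul_zero]
        intro h
        exact hr ⟨hr2, (le_div_iff₀ hk).2 (by linarith)⟩
      · rw [indicator_of_notMem hr2]
  calc _ ≤ ENNReal.ofReal (2 * Real.pi) * _ := mul_le_mul_right key _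
    _ = ENNReal.ofReal (2 * Real.pi) * (ENNReal.ofReal (k ^ γ) * ENNReal.ofReal ((A / k) ^ (γ + 2) / (γ + 2))) := by
        rw [lintegral_const_mul _ (by fun_prop), ← setLIntegral_congr Ioo_ae_eq_Ioc,
          lint_Ioo_rpow (by linarith) (by positivity), show γ + 1 + 1 = γ + 2 by ring]
    _ = _ := by
        rw [← ENNReal.ofReal_mul (by positivity), ← ENNReal.ofReal_mul (by positivity)]
        congr 1
        ring

lemma trid_coord {r R : ℝ} {ζ : ℂ} :
    ‖1 - (r : ℂ) * (starRingEnd ℂ) ζ‖ ^ 2 - (1 - (‖ζ‖ ^ 2 + R)) * (1 - r ^ 2)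
      = ‖ζ - r‖ ^ 2 + (1 - r ^ 2) * R := by
  simp only [← Complex.normSq_eq_norm_sq, Complex.normSq_apply, Complex.sub_re, Complex.sub_im,
    Complex.mul_re, Complex.mul_im, Complex.conj_re, Complex.conj_im, Complex.one_re,
    Complex.one_im, Complex.ofReal_re, Complex.ofReal_im]
  ring

lemma QQ_le {γ A y S : ℝ} (hγ : γ ≤ 0) (hS : S ≤ A) (hy : y ≤ S) :
    (ENNReal.ofReal S) ^ γ ≤ QQ γ A y := by
  rw [QQ, if_pos (hy.trans hS)]
  obtain ⟨g, rfl⟩ : ∃ g, γ = -g := ⟨-γ, by ring⟩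
  rw [ENNReal.rpow_neg, ENNReal.rpow_neg, ENNReal.inv_le_inv]
  exact ENNReal.rpow_le_rpow (ENNReal.ofReal_le_ofReal hy) (by linarith)

lemma lint_local (m : ℕ) {c M : ℝ} (hc0 : c < 0) (hc : -2 * ((m + 1 : ℕ) : ℝ) < c) (hM : 0 < M) :
    ∃ C : ℝ≥0, ∀ z ∈ ball (0 : En (m + 1)) 1,
    ∫⁻ w : En (m + 1), QQ c (M * (1 - ‖z‖ ^ 2)) (Real.sqrt (trid w z))
      ≤ C * ENNReal.ofReal ((1 - ‖z‖ ^ 2) ^ (c + ((m + 1 : ℕ) : ℝ) + 1)) := by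
  obtain ⟨κ, hκ⟩ := lint_coord m
  have hn : (0 : ℝ) < ((m + 1 : ℕ) : ℝ) := by positivity
  set γ := c / ((m + 1 : ℕ) : ℝ) with hγ
  have hγ0 : γ < 0 := div_neg_of_neg_of_pos hc0 hn
  have hγ2 : -2 < γ := by rw [hγ, lt_div_iff₀ hn]; exact hc
  have hγ3 : 0 < γ + 2 := by linarith
  have hcγ : c = γ * ((m + 1 : ℕ) : ℝ) := by rw [hγ]; field_simp
  set K : ℝ := 2 * Real.pi / (γ + 2) with hK
  have hK0 : 0 < K := by positivity
  refine ⟨κ * (K ^ (m + 1) * (M ^ (γ + 2)) ^ (m + 1)).toNNReal, fun z hz => ?_⟩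
  set x := 1 - ‖z‖ ^ 2 with hx
  have hx0 : 0 < x := one_sub_pos hz
  have hG : ∀ w : En (m + 1), QQ c (M * x) (Real.sqrt (trid w z)) =
      (fun (R : ℝ) (u : ℂ) => QQ c (M * x) (Real.sqrt (‖1 - u‖ ^ 2 - (1 - R) * x))) (‖w‖ ^ 2) (herm z w) := by
    intro w
    simp only [trid, norm_one_sub_herm_comm w z, ← hx]
  simp_rw [hG]
  rw [hκ z (fun (R : ℝ) (u : ℂ) => QQ c (M * x) (Real.sqrt (‖1 - u‖ ^ 2 - (1 - R) * x))) (by fun_prop)]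
  have hin : ∀ (ζ : ℂ) (w : Fin m → ℂ), QQ c (M * x)
      (Real.sqrt (‖1 - (‖z‖ : ℂ) * (starRingEnd ℂ) ζ‖ ^ 2 - (1 - (‖ζ‖ ^ 2 + ∑ j, ‖w j‖ ^ 2)) * x))
      ≤ QQ γ (M * x) (1 * ‖ζ - ‖z‖‖) * ∏ j, QQ γ (M * x) (Real.sqrt x * ‖w j‖) := by
    intro ζ w
    rw [hx, trid_coord, ← hx]
    set S := Real.sqrt (‖ζ - ‖z‖‖ ^ 2 + x * ∑ j, ‖w j‖ ^ 2) with hS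
    by_cases hSM : S ≤ M * x
    swap
    · rw [QQ, if_neg hSM]; exact zero_le
    rw [QQ, if_pos hSM]
    have hsum : ∀ j, ‖w j‖ ^ 2 ≤ ∑ j, ‖w j‖ ^ 2 := fun j =>
      Finset.single_le_sum (f := fun j => ‖w j‖ ^ 2) (fun i _ => sq_nonneg _) (Finset.mem_univ j)
    have hsum0 : 0 ≤ ∑ j, ‖w j‖ ^ 2 := Finset.sum_nonneg fun i _ => sq_nonneg _
    have h1 : 1 * ‖ζ - ‖z‖‖ ≤ S := by
      rw [one_mul]
      apply Real.le_sqrt_of_sq_le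
      nlinarith
    have h2 : ∀ j, Real.sqrt x * ‖w j‖ ≤ S := by
      intro j
      apply Real.le_sqrt_of_sq_le
      rw [mul_pow, Real.sq_sqrt hx0.le]
      nlinarith [hsum j, sq_nonneg ‖ζ - ‖z‖‖]
    have h3 : (ENNReal.ofReal S) ^ c = (ENNReal.ofReal S) ^ γ * ∏ _j : Fin m, (ENNReal.ofReal S) ^ γ := by
      rw [hcγ, ENNReal.rpow_mul, ENNReal.rpow_natCast]
      simp [pow_succ, mul_comm]
    rw [h3]
    gcongr with j
    · exact QQ_le hγ0.le hSM h1
    · exact QQ_le hγ0.le hSM (h2 j)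
  have hI1 : ∫⁻ ζ : ℂ, QQ γ (M * x) (1 * ‖ζ - ‖z‖‖) ≤ ENNReal.ofReal (K * (M * x) ^ (γ + 2)) := by
    rw [lintegral_sub_right_eq_self (fun ζ : ℂ => QQ γ (M * x) (1 * ‖ζ‖))]
    have := lint_QQ (γ := γ) (A := M * x) (k := 1) hγ2 (by positivity) one_pos
    simpa using this
  have hI2 : ∫⁻ ζ : ℂ, QQ γ (M * x) (Real.sqrt x * ‖ζ‖) ≤ ENNReal.ofReal (K * (M ^ (γ + 2) * x ^ (γ + 1))) := by
    refine (lint_QQ hγ2 (by positivity) (Real.sqrt_pos.2 hx0)).trans (le_of_eq ?_)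
    congr 2
    have e1 : M * x / Real.sqrt x = M * Real.sqrt x := by
      rw [mul_div_assoc, Real.div_sqrt]
    rw [e1, Real.mul_rpow hM.le (Real.sqrt_nonneg _), mul_left_comm, ← Real.rpow_add (Real.sqrt_pos.2 hx0),
      Real.sqrt_eq_rpow, ← Real.rpow_mul hx0.le]
    congr 2
    ring
  calc _ ≤ (κ : ℝ≥0∞) * ∫⁻ ζ : ℂ, ∫⁻ w : Fin m → ℂ,
          QQ γ (M * x) (1 * ‖ζ - ‖z‖‖) * ∏ j, QQ γ (M * x) (Real.sqrt x * ‖w j‖) := by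
        gcongr with ζ w
        exact hin ζ w
    _ = κ * ((∫⁻ ζ : ℂ, QQ γ (M * x) (1 * ‖ζ - ‖z‖‖)) *
          (∫⁻ ζ : ℂ, QQ γ (M * x) (Real.sqrt x * ‖ζ‖)) ^ m) := by
        have : ∀ ζ : ℂ, ∫⁻ w : Fin m → ℂ,
          QQ γ (M * x) (1 * ‖ζ - ‖z‖‖) * ∏ j, QQ γ (M * x) (Real.sqrt x * ‖w j‖)
           = QQ γ (M * x) (1 * ‖ζ - ‖z‖‖) * (∫⁻ ζ : ℂ, QQ γ (M * x) (Real.sqrt x * ‖ζ‖)) ^ m := by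
          intro ζ
          rw [lintegral_const_mul _ (by fun_prop),
            lint_pi_prod m (fun ζ => QQ γ (M * x) (Real.sqrt x * ‖ζ‖)) (by fun_prop)]
        simp only [this]
        rw [lintegral_mul_const _ (by fun_prop)]
    _ ≤ κ * (ENNReal.ofReal (K * (M * x) ^ (γ + 2)) *
          (ENNReal.ofReal (K * (M ^ (γ + 2) * x ^ (γ + 1)))) ^ m) := by
        gcongr
    _ = κ * (ENNReal.ofReal (K ^ (m + 1) * (M ^ (γ + 2)) ^ (m + 1)) *
          ENNReal.ofReal (x ^ (c + ((m + 1 : ℕ) : ℝ) + 1))) := by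
        congr 1
        rw [← ENNReal.ofReal_pow (by positivity), ← ENNReal.ofReal_mul (by positivity),
          ← ENNReal.ofReal_mul (by positivity)]
        congr 1
        have e1 : x ^ (c + ((m + 1 : ℕ) : ℝ) + 1) = x ^ (γ + 2) * (x ^ (γ + 1)) ^ m := by
          rw [← Real.rpow_natCast, ← Real.rpow_mul hx0.le, ← Real.rpow_add hx0, hcγ]
          congr 1
          push_cast
          ring
        rw [e1, Real.mul_rpow hM.le hx0.le]
        ring
    _ = _ := by
        push_cast
        rw [mul_assoc]
        rfl


/-! ### The row estimate and the Schur test -/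

lemma rpow_comparable {x y : ℝ} (q : ℝ) (hx : 0 < x) (h1 : x / 6 ≤ y) (h2 : y ≤ 6 * x) :
    y ^ q ≤ 6 ^ |q| * x ^ q := by
  rcases le_total 0 q with h | h
  · calc y ^ q ≤ (6 * x) ^ q := Real.rpow_le_rpow (by linarith) h2 h
      _ = 6 ^ q * x ^ q := Real.mul_rpow (by norm_num) hx.le
      _ = _ := by rw [abs_of_nonneg h]
  · calc y ^ q ≤ (x / 6) ^ q := Real.rpow_le_rpow_of_nonpos (by positivity) h1 h
      _ = x ^ q / 6 ^ q := Real.div_rpow hx.le (by norm_num) _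
      _ = _ := by rw [abs_of_nonpos h, Real.rpow_neg (by norm_num)]; field_simp

lemma trid_nonneg {n : ℕ} {w z : En n} (hz : z ∈ ball (0 : En n) 1) : 0 ≤ trid w z := by
  rw [trid_formula]
  have := one_sub_pos hz
  positivity

lemma sqrt_trid_le {n : ℕ} {w z : En n} (hz : z ∈ ball (0 : En n) 1) (hw : w ∈ ball (0 : En n) 1) :
    Real.sqrt (trid w z) ≤ ‖1 - herm z w‖ := by
  apply Real.sqrt_le_iff.2 ⟨norm_nonneg _, ?_⟩
  rw [trid, norm_one_sub_herm_comm w z]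
  nlinarith [one_sub_pos hz, one_sub_pos hw]

lemma pointwise_far {x y S E α t p c : ℝ} (hx : 0 < x) (hy : 0 < y) (hE : 0 < E) (hS0 : 0 ≤ S)
    (hSE : S ≤ E) (h : 0 ≤ c ∨ E / 2 ≤ S) :
    ENNReal.ofReal (x ^ α * y ^ t * S ^ c * E ^ (-(p + c))) ≤
      ENNReal.ofReal (2 ^ |c| * x ^ α) * (PP t y * ENNReal.ofReal (E ^ (-p))) := by
  rw [PP_pos hy, ← ENNReal.ofReal_mul (by positivity), ← ENNReal.ofReal_mul (by positivity)]
  apply ENNReal.ofReal_le_ofReal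
  have h1 : S ^ c ≤ 2 ^ |c| * E ^ c := by
    by_cases hc : 0 ≤ c
    · calc S ^ c ≤ E ^ c := Real.rpow_le_rpow hS0 hSE hc
        _ = 1 * E ^ c := (one_mul _).symm
        _ ≤ _ := by
          gcongr
          exact Real.one_le_rpow (by norm_num) (abs_nonneg _)
    · have h2 := h.resolve_left hc
      push Not at hc
      calc S ^ c ≤ (E / 2) ^ c := Real.rpow_le_rpow_of_nonpos (by positivity) h2 hc.le
        _ = E ^ c / 2 ^ c := Real.div_rpow hE.le (by norm_num) _
        _ = _ := by rw [abs_of_neg hc, Real.rpow_neg (by norm_num)]; field_simp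
  have h3 : E ^ (-p) = E ^ c * E ^ (-(p + c)) := by
    rw [← Real.rpow_add hE]; congr 1; ring
  rw [h3]
  calc _ ≤ x ^ α * y ^ t * (2 ^ |c| * E ^ c) * E ^ (-(p + c)) := by gcongr
    _ = _ := by ring

lemma pointwise_near {x y S E α t p c : ℝ} (hx : 0 < x) (hE : 0 < E) (hS0 : 0 ≤ S)
    (hxE : x / 2 ≤ E) (hyE : y / 2 ≤ E) (hid : S ^ 2 = E ^ 2 - y * x) (hc : c < 0) (h : S < E / 2) :
    ENNReal.ofReal (x ^ α * y ^ t * S ^ c * E ^ (-(p + c))) ≤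
      ENNReal.ofReal (6 ^ |t| * 6 ^ |p + c| * x ^ (α + t - (p + c))) * QQ c (2 * x) S := by
  have h1 : 3 / 4 * E ^ 2 ≤ y * x := by nlinarith
  have hEx : E ≤ 3 * x := by
    by_contra hcon
    push Not at hcon
    nlinarith
  have hEy : E ≤ 3 * y := by
    by_contra hcon
    push Not at hcon
    nlinarith
  have hy : 0 < y := by linarith
  have e1 : y ^ t ≤ 6 ^ |t| * x ^ t := rpow_comparable t hx (by linarith) (by linarith)
  have e2 : E ^ (-(p + c)) ≤ 6 ^ |p + c| * x ^ (-(p + c)) := by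
    have := rpow_comparable (-(p + c)) hx (y := E) (by linarith) (by linarith)
    rwa [abs_neg] at this
  rw [QQ, if_pos (by linarith)]
  rcases hS0.eq_or_lt with h0 | h0
  · rw [← h0, Real.zero_rpow hc.ne]; simp
  rw [ENNReal.ofReal_rpow_of_pos h0, ← ENNReal.ofReal_mul (by positivity)]
  apply ENNReal.ofReal_le_ofReal
  have e3 : x ^ (α + t - (p + c)) = x ^ α * x ^ t * x ^ (-(p + c)) := by
    rw [← Real.rpow_add hx, ← Real.rpow_add hx]; rfl
  rw [e3]
  calc _ ≤ x ^ α * (6 ^ |t| * x ^ t) * S ^ c * (6 ^ |p + c| * x ^ (-(p + c))) := by gcongr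
    _ = _ := by ring

lemma row_bound (m : ℕ) {α β c : ℝ} (hα : ((m + 1 : ℕ) : ℝ) / 2 < α) (hβ : ((m + 1 : ℕ) : ℝ) / 2 < β)
    (hc : -2 * ((m + 1 : ℕ) : ℝ) < c) : ∃ C : ℝ≥0, ∀ z ∈ ball (0 : En (m + 1)) 1,
    ∫⁻ w in ball (0 : En (m + 1)) 1, ENNReal.ofReal ((1 - ‖z‖ ^ 2) ^ α *
        (1 - ‖w‖ ^ 2) ^ (β + ((m + 1 : ℕ) : ℝ) / 2 - ((m + 1 : ℕ) : ℝ) - 1) *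
        Real.sqrt (trid w z) ^ c * ‖1 - herm z w‖ ^ (-(α + β + c)))
      ≤ C * ENNReal.ofReal ((1 - ‖z‖ ^ 2) ^ (((m + 1 : ℕ) : ℝ) / 2)) := by
  set N : ℝ := ((m + 1 : ℕ) : ℝ) with hN
  set t := β + N / 2 - N - 1 with ht
  obtain ⟨C1, hC1⟩ := lint_FR_ball m (t := t) (s := α - N / 2) (by rw [ht]; linarith) (by linarith)
  have hexp : N + 1 + t + (α - N / 2) = α + β := by rw [ht]; ring
  rw [← hN, hexp] at hC1
  have hfar : ∀ z ∈ ball (0 : En (m + 1)) 1, ∫⁻ w : En (m + 1),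
      ENNReal.ofReal (2 ^ |c| * (1 - ‖z‖ ^ 2) ^ α) * (PP t (1 - ‖w‖ ^ 2) *
        ENNReal.ofReal (‖1 - herm z w‖ ^ (-(α + β)))) ≤
      ENNReal.ofReal (2 ^ |c|) * C1 * ENNReal.ofReal ((1 - ‖z‖ ^ 2) ^ (N / 2)) := by
    intro z hz
    have hx := one_sub_pos hz
    have hm : Measurable (fun w : En (m + 1) => herm z w) :=
      (continuous_herm.comp (Continuous.prodMk_right z)).measurable
    rw [lintegral_const_mul _ (by fun_prop)]
    calc _ ≤ ENNReal.ofReal (2 ^ |c| * (1 - ‖z‖ ^ 2) ^ α) * (C1 * ENNReal.ofReal ((1 - ‖z‖ ^ 2) ^ (-(α - N / 2)))) := by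
          gcongr
          exact hC1 z hz
      _ = _ := by
          have : (1 - ‖z‖ ^ 2) ^ (N / 2) = (1 - ‖z‖ ^ 2) ^ α * (1 - ‖z‖ ^ 2) ^ (-(α - N / 2)) := by
            rw [← Real.rpow_add hx]; congr 1; ring
          rw [this, ENNReal.ofReal_mul (by positivity), ENNReal.ofReal_mul (by positivity)]
          ring
  by_cases hc0 : 0 ≤ c
  · refine ⟨(2 ^ |c| : ℝ).toNNReal * C1, fun z hz => ?_⟩
    refine le_trans (le_trans ?_ (setLIntegral_le_lintegral (ball (0 : En (m + 1)) 1) _)) ((hfar z hz).trans (le_of_eq ?_))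
    · apply setLIntegral_mono' measurableSet_ball
      intro w hw
      exact pointwise_far (one_sub_pos hz) (one_sub_pos hw) (E_pos hz hw) (Real.sqrt_nonneg _)
        (sqrt_trid_le hz hw) (Or.inl hc0)
    · push_cast; rfl
  push Not at hc0
  obtain ⟨C2, hC2⟩ := lint_local m (c := c) (M := 2) hc0 hc two_pos
  refine ⟨(2 ^ |c| : ℝ).toNNReal * C1 + (6 ^ |t| * 6 ^ |α + β + c| : ℝ).toNNReal * C2, fun z hz => ?_⟩
  have hx := one_sub_pos hz
  have hm : Measurable (fun w : En (m + 1) => herm z w) :=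
      (continuous_herm.comp (Continuous.prodMk_right z)).measurable
  have hnear : ∫⁻ w : En (m + 1), ENNReal.ofReal (6 ^ |t| * 6 ^ |α + β + c| *
      (1 - ‖z‖ ^ 2) ^ (α + t - (α + β + c))) * QQ c (2 * (1 - ‖z‖ ^ 2)) (Real.sqrt (trid w z)) ≤
      ENNReal.ofReal (6 ^ |t| * 6 ^ |α + β + c|) * C2 * ENNReal.ofReal ((1 - ‖z‖ ^ 2) ^ (N / 2)) := by
    have hm2 : Measurable (fun w : En (m + 1) => trid w z) :=
      (continuous_trid.comp (Continuous.prodMk_left z)).measurable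
    rw [lintegral_const_mul _ (by fun_prop)]
    calc _ ≤ ENNReal.ofReal (6 ^ |t| * 6 ^ |α + β + c| *
          (1 - ‖z‖ ^ 2) ^ (α + t - (α + β + c))) * (C2 * ENNReal.ofReal ((1 - ‖z‖ ^ 2) ^ (c + N + 1))) := by
          gcongr
          exact hC2 z hz
      _ = _ := by
          have : (1 - ‖z‖ ^ 2) ^ (N / 2) = (1 - ‖z‖ ^ 2) ^ (α + t - (α + β + c)) * (1 - ‖z‖ ^ 2) ^ (c + N + 1) := by
            rw [← Real.rpow_add hx]; congr 1; rw [ht]; ring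
          rw [this, ENNReal.ofReal_mul (by positivity), ENNReal.ofReal_mul (q := (1 - ‖z‖ ^ 2) ^ (c + N + 1)) (by positivity)]
          ring
  calc _ ≤ ∫⁻ w in ball (0 : En (m + 1)) 1, (ENNReal.ofReal (2 ^ |c| * (1 - ‖z‖ ^ 2) ^ α) * (PP t (1 - ‖w‖ ^ 2) *
        ENNReal.ofReal (‖1 - herm z w‖ ^ (-(α + β)))) + ENNReal.ofReal (6 ^ |t| * 6 ^ |α + β + c| *
      (1 - ‖z‖ ^ 2) ^ (α + t - (α + β + c))) * QQ c (2 * (1 - ‖z‖ ^ 2)) (Real.sqrt (trid w z))) := by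
        apply setLIntegral_mono' measurableSet_ball
        intro w hw
        rcases le_or_gt (‖1 - herm z w‖ / 2) (Real.sqrt (trid w z)) with h | h
        · exact (pointwise_far hx (one_sub_pos hw) (E_pos hz hw) (Real.sqrt_nonneg _)
            (sqrt_trid_le hz hw) (Or.inr h)).trans le_self_add
        · refine (pointwise_near hx (E_pos hz hw) (Real.sqrt_nonneg _)
            (half_le_E hz hw) (half_le_E' hz hw) ?_ hc0 h).trans le_add_self
          rw [Real.sq_sqrt (trid_nonneg hz), trid, norm_one_sub_herm_comm w z]
    _ ≤ ∫⁻ w : En (m + 1), (ENNReal.ofReal (2 ^ |c| * (1 - ‖z‖ ^ 2) ^ α) * (PP t (1 - ‖w‖ ^ 2) *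
        ENNReal.ofReal (‖1 - herm z w‖ ^ (-(α + β)))) + ENNReal.ofReal (6 ^ |t| * 6 ^ |α + β + c| *
      (1 - ‖z‖ ^ 2) ^ (α + t - (α + β + c))) * QQ c (2 * (1 - ‖z‖ ^ 2)) (Real.sqrt (trid w z))) :=
        setLIntegral_le_lintegral _ _
    _ ≤ _ := by
        rw [lintegral_add_left (by fun_prop)]
        refine (add_le_add (hfar z hz) hnear).trans (le_of_eq ?_)
        push_cast
        rw [add_mul]
        rfl

lemma cauchy_schwarz_sq {α : Type*} [MeasurableSpace α] (μ : Measure α) (f g : α → ℝ≥0∞)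
    (hf : AEMeasurable f μ) (hg : AEMeasurable g μ) :
    (∫⁻ x, f x ^ (1 / 2 : ℝ) * g x ^ (1 / 2 : ℝ) ∂μ) ^ 2 ≤ (∫⁻ x, f x ∂μ) * ∫⁻ x, g x ∂μ := by
  have h := ENNReal.lintegral_mul_le_Lp_mul_Lq μ Real.HolderConjugate.two_two
    (hf.pow_const (1 / 2 : ℝ)) (hg.pow_const (1 / 2 : ℝ))
  have e : ∀ u : ℝ≥0∞, (u ^ (1 / 2 : ℝ)) ^ (2 : ℝ) = u := by
    intro u
    rw [← ENNReal.rpow_mul]; norm_num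
  simp only [Pi.mul_apply, e] at h
  calc _ ≤ ((∫⁻ x, f x ∂μ) ^ (1 / 2 : ℝ) * (∫⁻ x, g x ∂μ) ^ (1 / 2 : ℝ)) ^ 2 := by gcongr
    _ = _ := by
      rw [mul_pow, ← ENNReal.rpow_two, ← ENNReal.rpow_two, e, e]

lemma schur_test {α : Type*} [MeasurableSpace α] (μ : Measure α) [SFinite μ]
    (k : α → α → ℝ≥0∞) (hk : Measurable (fun p : α × α => k p.1 p.2)) (g ω : α → ℝ≥0∞)
    (hgm : Measurable g) (hωm : Measurable ω) (hg : ∀ᵐ w ∂μ, g w ≠ 0 ∧ g w ≠ ⊤) (C : ℝ≥0)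
    (hrow : ∀ᵐ z ∂μ, ∫⁻ w, k z w * g w ∂μ ≤ C * g z)
    (hcol : ∀ᵐ w ∂μ, ∫⁻ z, k z w * (g z * ω z) ∂μ ≤ C * (g w * ω w))
    (h : α → ℝ≥0∞) (hh : Measurable h) :
    ∫⁻ z, ω z * (∫⁻ w, k z w * h w ∂μ) ^ 2 ∂μ ≤ (C : ℝ≥0∞) ^ 2 * ∫⁻ w, ω w * (h w) ^ 2 ∂μ := by
  have hkz : ∀ z, Measurable (k z) := fun z => hk.comp measurable_prodMk_left
  have hkw : ∀ w, Measurable (fun z => k z w) := fun w => hk.comp measurable_prodMk_right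
  have hs : ∀ z, (∫⁻ w, k z w * h w ∂μ) ^ 2 ≤
      (∫⁻ w, k z w * g w ∂μ) * ∫⁻ w, k z w * (h w ^ 2 * (g w)⁻¹) ∂μ := by
    intro z
    have hkz' := hkz z
    refine le_trans (le_of_eq ?_) (cauchy_schwarz_sq μ _ _ (by fun_prop) (by fun_prop))
    congr 1
    apply lintegral_congr_ae
    filter_upwards [hg] with w hw
    rw [← ENNReal.mul_rpow_of_nonneg _ _ (by norm_num)]
    have : k z w * g w * (k z w * (h w ^ 2 * (g w)⁻¹)) = (k z w * h w) ^ (2 : ℝ) := by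
      rw [ENNReal.rpow_two]
      calc _ = (k z w * h w) ^ 2 * (g w * (g w)⁻¹) := by ring
        _ = _ := by rw [ENNReal.mul_inv_cancel hw.1 hw.2, mul_one]
    rw [this, ← ENNReal.rpow_mul]
    norm_num
  calc _ ≤ ∫⁻ z, (C : ℝ≥0∞) * ∫⁻ w, (k z w * (g z * ω z)) * (h w ^ 2 * (g w)⁻¹) ∂μ ∂μ := by
        apply lintegral_mono_ae
        filter_upwards [hrow] with z hz
        have hkz' := hkz z
        calc _ ≤ ω z * ((C * g z) * ∫⁻ w, k z w * (h w ^ 2 * (g w)⁻¹) ∂μ) := by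
              gcongr
              exact (hs z).trans (by gcongr)
          _ = C * ((g z * ω z) * ∫⁻ w, k z w * (h w ^ 2 * (g w)⁻¹) ∂μ) := by ring
          _ = _ := by
              rw [← lintegral_const_mul _ (by fun_prop)]
              congr 1
              apply lintegral_congr
              intro w
              ring
    _ = C * ∫⁻ z, ∫⁻ w, (k z w * (g z * ω z)) * (h w ^ 2 * (g w)⁻¹) ∂μ ∂μ := by
        rw [lintegral_const_mul]
        exact Measurable.lintegral_prod_right' (f := fun p : α × α => (k p.1 p.2 * (g p.1 * ω p.1)) * (h p.2 ^ 2 * (g p.2)⁻¹)) (by fun_prop)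
    _ = C * ∫⁻ w, ∫⁻ z, (k z w * (g z * ω z)) * (h w ^ 2 * (g w)⁻¹) ∂μ ∂μ := by
        rw [lintegral_lintegral_swap]
        exact (by fun_prop : Measurable (fun p : α × α => (k p.1 p.2 * (g p.1 * ω p.1)) * (h p.2 ^ 2 * (g p.2)⁻¹))).aemeasurable
    _ ≤ C * ∫⁻ w, C * (ω w * h w ^ 2) ∂μ := by
        gcongr 1
        apply lintegral_mono_ae
        filter_upwards [hcol, hg] with w hw hgw
        have := hkw w
        rw [lintegral_mul_const _ (by fun_prop)]
        calc _ ≤ (C * (g w * ω w)) * (h w ^ 2 * (g w)⁻¹) := by gcongr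
          _ = C * (ω w * h w ^ 2) * (g w * (g w)⁻¹) := by ring
          _ = _ := by rw [ENNReal.mul_inv_cancel hgw.1 hgw.2, mul_one]
    _ = _ := by
        rw [lintegral_const_mul _ (by fun_prop)]
        ring


/-! ### The operator -/

/-- The kernel of `T_{a,b,c}`. -/
def ker (n : ℕ) (a b c : ℝ) (z w : En n) : ℝ :=
  (1 - ‖z‖ ^ 2) ^ a * (1 - ‖w‖ ^ 2) ^ b * Real.sqrt (trid w z) ^ c *
        ‖1 - herm z w‖ ^ (-((n : ℝ) + 1 + a + b + c))

/-- The density of `λ_n`. -/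
def om (n : ℕ) (z : En n) : ℝ≥0∞ := ENNReal.ofReal ((1 - ‖z‖ ^ 2) ^ (-(n : ℝ) - 1))

lemma Tabc_eq {n : ℕ} (a b c : ℝ) (h : En n → ℝ≥0∞) (z : En n) :
    Tabc a b c h z = ∫⁻ w in ball (0 : En n) 1, ENNReal.ofReal (ker n a b c z w) * h w := rfl

lemma measurable_ker (n : ℕ) (a b c : ℝ) :
    Measurable (fun p : En n × En n => ENNReal.ofReal (ker n a b c p.1 p.2)) := by
  have h1 : Measurable (fun p : En n × En n => herm p.1 p.2) := continuous_herm.measurable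
  have h2 : Measurable (fun p : En n × En n => trid p.2 p.1) :=
    (continuous_trid.comp continuous_swap).measurable
  unfold ker
  fun_prop

lemma measurable_Tabc {n : ℕ} (a b c : ℝ) (h : En n → ℝ≥0∞) (hh : Measurable h) :
    Measurable (Tabc a b c h) := by
  have hk := measurable_ker n a b c
  exact Measurable.lintegral_prod_right'
    (f := fun p : En n × En n => ENNReal.ofReal (ker n a b c p.1 p.2) * h p.2) (by fun_prop)

@[fun_prop]
lemma measurable_om (n : ℕ) : Measurable (om n) := by
  unfold om
  fun_prop

lemma lint_lambda {n : ℕ} (F : En n → ℝ≥0∞) (hF : Measurable F) :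
    ∫⁻ z, F z ∂(lambdaM n) = ∫⁻ z in ball (0 : En n) 1, om n z * F z := by
  unfold lambdaM
  exact lintegral_withDensity_eq_lintegral_mul _ (measurable_om n) hF

theorem Tabc_sufficient (m : ℕ) (a b c : ℝ) (hc : -2 * ((m + 1 : ℕ) : ℝ) < c)
    (ha : -2 * a < -((m + 1 : ℕ) : ℝ)) (hb : -((m + 1 : ℕ) : ℝ) < 2 * (b + 1)) :
    ∃ C : ℝ, ∀ h : En (m + 1) → ℝ≥0∞, Measurable h →
          (∫⁻ z, (Tabc a b c h z) ^ 2 ∂(lambdaM (m + 1))) ≤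
            ENNReal.ofReal (C ^ 2) * ∫⁻ z, (h z) ^ 2 ∂(lambdaM (m + 1)) := by
  set N : ℝ := ((m + 1 : ℕ) : ℝ) with hN
  obtain ⟨C1, hC1⟩ := row_bound m (α := a) (β := b + N + 1) (c := c) (by linarith) (by linarith) hc
  obtain ⟨C2, hC2⟩ := row_bound m (α := b + N + 1) (β := a) (c := c) (by linarith) (by linarith) hc
  rw [← hN] at hC1 hC2
  refine ⟨(max C1 C2 : ℝ≥0), fun h hh => ?_⟩
  rw [lint_lambda _ ((measurable_Tabc a b c h hh).pow_const 2), lint_lambda _ (hh.pow_const 2)]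
  have e : ENNReal.ofReal (((max C1 C2 : ℝ≥0) : ℝ) ^ 2) = ((max C1 C2 : ℝ≥0) : ℝ≥0∞) ^ 2 := by
    rw [ENNReal.ofReal_pow (NNReal.coe_nonneg _), ENNReal.ofReal_coe_nnreal]
  rw [e]
  simp only [Tabc_eq]
  refine schur_test (volume.restrict (ball (0 : En (m + 1)) 1))
    (fun z w => ENNReal.ofReal (ker (m + 1) a b c z w)) (measurable_ker _ a b c)
    (fun w => ENNReal.ofReal ((1 - ‖w‖ ^ 2) ^ (N / 2))) (om (m + 1)) (by fun_prop) (by fun_prop)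
    ?_ (max C1 C2) ?_ ?_ h hh
  · filter_upwards [ae_restrict_mem measurableSet_ball] with w hw
    have := one_sub_pos hw
    exact ⟨by rw [Ne, ENNReal.ofReal_eq_zero, not_le]; positivity, ENNReal.ofReal_ne_top⟩
  · filter_upwards [ae_restrict_mem measurableSet_ball] with z hz
    have hx := one_sub_pos hz
    refine le_trans (le_trans (le_of_eq ?_) (hC1 z hz)) (by gcongr; exact le_max_left _ _)
    apply setLIntegral_congr_fun measurableSet_ball
    intro w hw
    have hy := one_sub_pos hw
    simp only
    rw [mul_comm, ← ENNReal.ofReal_mul (by positivity)]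
    congr 1
    have e1 : (1 - ‖w‖ ^ 2) ^ (b + N + 1 + N / 2 - N - 1) = (1 - ‖w‖ ^ 2) ^ b * (1 - ‖w‖ ^ 2) ^ (N / 2) := by
      rw [← Real.rpow_add hy]; congr 1; ring
    rw [e1, ker, ← hN, show a + (b + N + 1) + c = N + 1 + a + b + c by ring]
    ring
  · filter_upwards [ae_restrict_mem measurableSet_ball] with w hw
    have hy := one_sub_pos hw
    have key : ∀ z ∈ ball (0 : En (m + 1)) 1, ENNReal.ofReal (ker (m + 1) a b c z w) *
        (ENNReal.ofReal ((1 - ‖z‖ ^ 2) ^ (N / 2)) * om (m + 1) z) =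
        om (m + 1) w * ENNReal.ofReal ((1 - ‖w‖ ^ 2) ^ (b + N + 1) *
        (1 - ‖z‖ ^ 2) ^ (a + N / 2 - N - 1) *
        Real.sqrt (trid z w) ^ c * ‖1 - herm w z‖ ^ (-(b + N + 1 + a + c))) := by
      intro z hz
      have hx := one_sub_pos hz
      rw [om, om, ← ENNReal.ofReal_mul (by positivity), mul_comm, ← ENNReal.ofReal_mul (by positivity),
        ← ENNReal.ofReal_mul (by positivity)]
      congr 1
      have e1 : (1 - ‖z‖ ^ 2) ^ (a + N / 2 - N - 1) =
          (1 - ‖z‖ ^ 2) ^ a * ((1 - ‖z‖ ^ 2) ^ (N / 2) * (1 - ‖z‖ ^ 2) ^ (-N - 1)) := by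
        rw [← Real.rpow_add hx, ← Real.rpow_add hx]; congr 1; ring
      have e2 : (1 - ‖w‖ ^ 2) ^ b = (1 - ‖w‖ ^ 2) ^ (-N - 1) * (1 - ‖w‖ ^ 2) ^ (b + N + 1) := by
        rw [← Real.rpow_add hy]; congr 1; ring
      rw [e1, ker, e2, ← hN, trid_comm z w, norm_one_sub_herm_comm w z,
        show b + N + 1 + a + c = N + 1 + a + b + c by ring]
      ring
    rw [setLIntegral_congr_fun measurableSet_ball key]
    rw [lintegral_const_mul' _ _ (show om (m + 1) w ≠ ⊤ from ENNReal.ofReal_ne_top)]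
    calc _ ≤ om (m + 1) w * (C2 * ENNReal.ofReal ((1 - ‖w‖ ^ 2) ^ (N / 2))) := by
          gcongr
          exact hC2 w hw
      _ = C2 * (ENNReal.ofReal ((1 - ‖w‖ ^ 2) ^ (N / 2)) * om (m + 1) w) := by ring
      _ ≤ _ := by gcongr; exact le_max_right _ _


/-! ### Necessity -/

lemma rpow_ge_of_mem {v : ℝ} (q : ℝ) (h1 : 1 / 2 ≤ v) (h2 : v ≤ 2) : (2 : ℝ) ^ (-|q|) ≤ v ^ q := by
  rcases le_total 0 q with h | h
  · rw [abs_of_nonneg h, Real.rpow_neg (by norm_num), ← Real.inv_rpow (by norm_num)]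
    exact Real.rpow_le_rpow (by norm_num) (by linarith) h
  · rw [abs_of_nonpos h, neg_neg]
    exact Real.rpow_le_rpow_of_nonpos (by linarith) h2 h

lemma rpow_le_of_mem {v : ℝ} (q : ℝ) (h1 : 1 / 2 ≤ v) (h2 : v ≤ 2) : v ^ q ≤ (2 : ℝ) ^ |q| := by
  have h := rpow_ge_of_mem (-q) h1 h2
  rw [abs_neg, Real.rpow_neg (by norm_num : (0:ℝ) ≤ 2), Real.rpow_neg (by linarith : (0:ℝ) ≤ v)] at h
  exact (inv_le_inv₀ (by positivity) (Real.rpow_pos_of_pos (by linarith) _)).1 h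

lemma finrank_En (n : ℕ) : Module.finrank ℝ (En n) = 2 * n := by
  rw [finrank_real_of_complex]
  simp

lemma nontrivial_En {n : ℕ} (hn : 1 ≤ n) : Nontrivial (En n) := by
  apply Module.nontrivial_of_finrank_pos (R := ℝ)
  rw [finrank_En]
  omega

lemma lint_norm_top {n : ℕ} (hn : 1 ≤ n) {c r : ℝ} (hr : 0 < r) (hc : c ≤ -2 * (n : ℝ)) :
    ∫⁻ w in ball (0 : En n) r, ENNReal.ofReal (‖w‖ ^ c) = ⊤ := by
  have := nontrivial_En hn
  by_contra hne
  have hintg : IntegrableOn (fun w : En n => (fun y : ℝ => y ^ c) ‖w‖) (ball (0 : En n) r) := by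
    refine ⟨(by fun_prop : Measurable (fun w : En n => ‖w‖ ^ c)).aestronglyMeasurable, ?_⟩
    rw [hasFiniteIntegral_iff_ofReal]
    · exact lt_top_iff_ne_top.2 hne
    · exact Filter.Eventually.of_forall fun w => Real.rpow_nonneg (norm_nonneg w) _
  have hintg2 := (integrableOn_fun_norm_addHaar (volume : Measure (En n)) (f := fun y : ℝ => y ^ c) (r := r)).1 hintg
  have h2 : IntegrableOn (fun y : ℝ => y ^ (2 * (n : ℝ) - 1 + c)) (Ioo 0 r) := by
    refine hintg2.congr_fun (fun y hy => ?_) measurableSet_Ioo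
    have hy0 : 0 < y := hy.1
    simp only [smul_eq_mul]
    rw [finrank_En, Real.rpow_add hy0, ← Real.rpow_natCast]
    congr 2
    rw [Nat.cast_sub (by omega)]
    push_cast
    ring
  rw [intervalIntegral.integrableOn_Ioo_rpow_iff hr] at h2
  linarith

/-- The outer annulus. -/
def ann (n : ℕ) : Set (En n) := {w | 3 / 4 < ‖w‖ ∧ ‖w‖ < 1}

lemma measurableSet_ann (n : ℕ) : MeasurableSet (ann n) :=
  (measurableSet_lt measurable_const measurable_norm).inter
    (measurableSet_lt measurable_norm measurable_const)

lemma ann_subset (n : ℕ) : ann n ⊆ ball (0 : En n) 1 := fun _ hw => mem_ball_zero_iff.2 hw.2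

lemma lint_ann_top {n : ℕ} (hn : 1 ≤ n) {q : ℝ} (hq : q ≤ -1) :
    ∫⁻ w in ann n, ENNReal.ofReal ((1 - ‖w‖ ^ 2) ^ q) = ⊤ := by
  have := nontrivial_En hn
  by_contra hne
  set f : ℝ → ℝ := (Ioo (3 / 4) 1).indicator (fun y => (1 - y ^ 2) ^ q) with hf
  have hfm : Measurable f := Measurable.indicator (by fun_prop) measurableSet_Ioo
  have hintg : Integrable (fun w : En n => f ‖w‖) := by
    have h1 : (fun w : En n => f ‖w‖) = (ann n).indicator (fun w => (1 - ‖w‖ ^ 2) ^ q) := by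
      ext w
      by_cases hw : w ∈ ann n
      · rw [indicator_of_mem hw, hf, indicator_of_mem (show ‖w‖ ∈ Ioo (3 / 4) 1 from hw)]
      · rw [indicator_of_notMem hw, hf, indicator_of_notMem (show ‖w‖ ∉ Ioo (3 / 4) 1 from hw)]
    rw [h1, integrable_indicator_iff (measurableSet_ann n)]
    refine ⟨(by fun_prop : Measurable (fun w : En n => (1 - ‖w‖ ^ 2) ^ q)).aestronglyMeasurable, ?_⟩
    rw [hasFiniteIntegral_iff_ofReal]
    · exact lt_top_iff_ne_top.2 hne
    · filter_upwards [ae_restrict_mem (measurableSet_ann n)] with w hw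
      exact Real.rpow_nonneg (one_sub_pos (ann_subset n hw)).le _
  rw [integrable_fun_norm_addHaar] at hintg
  set d := Module.finrank ℝ (En n) - 1 with hd
  have h2 : IntegrableOn (fun y : ℝ => (1 - y) ^ q) (Ioo (3 / 4) 1) := by
    have h3 := (hintg.mono_set (show Ioo (3 / 4 : ℝ) 1 ⊆ Ioi 0 from
      fun y hy => lt_trans (by norm_num) hy.1)).const_mul ((4 / 3 : ℝ) ^ d * 2 ^ (-q))
    refine Integrable.mono' h3
      (by fun_prop : Measurable (fun y : ℝ => (1 - y) ^ q)).aestronglyMeasurable ?_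
    filter_upwards [ae_restrict_mem measurableSet_Ioo] with y hy
    have hy1 : 0 < 1 - y := by linarith [hy.2]
    have hy2 : 0 < 1 - y ^ 2 := by nlinarith [hy.1, hy.2]
    rw [Real.norm_of_nonneg (by positivity), hf, indicator_of_mem hy, smul_eq_mul]
    have e1 : (2 * (1 - y)) ^ q ≤ (1 - y ^ 2) ^ q :=
      Real.rpow_le_rpow_of_nonpos hy2 (by nlinarith [hy.1, hy.2]) (by linarith)
    have e2 : (1 - y) ^ q = 2 ^ (-q) * (2 * (1 - y)) ^ q := by
      rw [Real.mul_rpow (by norm_num) hy1.le, Real.rpow_neg (by norm_num)]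
      field_simp
    have e3 : (1 : ℝ) ≤ (4 / 3) ^ d * y ^ d := by
      rw [← mul_pow]
      exact one_le_pow₀ (by linarith [hy.1])
    calc (1 - y) ^ q = 1 * (2 ^ (-q) * (2 * (1 - y)) ^ q) := by rw [one_mul]; exact e2
      _ ≤ ((4 / 3) ^ d * y ^ d) * (2 ^ (-q) * (1 - y ^ 2) ^ q) := by gcongr
      _ = _ := by ring
  have h4 : IntegrableOn (fun y : ℝ => y ^ q) (Ioo 0 (1 / 4)) := by
    have h := (Measure.measurePreserving_sub_left (volume : Measure ℝ) 1).integrableOn_comp_preimage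
      (MeasurableEquiv.subLeft (1 : ℝ)).measurableEmbedding (f := fun y : ℝ => y ^ q) (s := Ioo 0 (1 / 4))
    rw [← h]
    refine h2.mono_set ?_
    intro y hy
    simp only [mem_preimage, mem_Ioo] at hy
    exact ⟨by linarith [hy.2], by linarith [hy.1]⟩
  rw [intervalIntegral.integrableOn_Ioo_rpow_iff (by norm_num)] at h4
  linarith

lemma om_small {n : ℕ} {w : En n} (hw : ‖w‖ ≤ 1 / 2) :
    ENNReal.ofReal (2 ^ (-|(-(n : ℝ) - 1)|)) ≤ om n w ∧ om n w ≤ ENNReal.ofReal (2 ^ |(-(n : ℝ) - 1)|) := by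
  have h1 : 1 / 2 ≤ 1 - ‖w‖ ^ 2 := by nlinarith [norm_nonneg w]
  have h2 : 1 - ‖w‖ ^ 2 ≤ 2 := by nlinarith [norm_nonneg w]
  exact ⟨ENNReal.ofReal_le_ofReal (rpow_ge_of_mem _ h1 h2), ENNReal.ofReal_le_ofReal (rpow_le_of_mem _ h1 h2)⟩

lemma smallball_subset {n : ℕ} {r : ℝ} (hr : r ≤ 1 / 2) : ball (0 : En n) r ⊆ ball (0 : En n) 1 :=
  ball_subset_ball (by linarith)

/-- Finite `L²(λ)` norm of the indicator of a small ball. -/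
lemma ind_finite (n : ℕ) {r : ℝ} (hr : r ≤ 1 / 2) :
    ∫⁻ z, ((ball (0 : En n) r).indicator (fun _ => (1 : ℝ≥0∞)) z) ^ 2 ∂(lambdaM n) < ⊤ := by
  rw [lint_lambda _ ((measurable_const.indicator measurableSet_ball).pow_const 2)]
  calc _ ≤ ∫⁻ z in ball (0 : En n) 1, ENNReal.ofReal (2 ^ |(-(n : ℝ) - 1)|) := by
        apply lintegral_mono
        intro z
        by_cases hz : z ∈ ball (0 : En n) r
        · simp only [indicator_of_mem hz, one_pow, mul_one]
          exact (om_small (by linarith [mem_ball_zero_iff.1 hz])).2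
        · simp [indicator_of_notMem hz]
    _ < ⊤ := by
        rw [setLIntegral_const]
        exact ENNReal.mul_lt_top ENNReal.ofReal_lt_top measure_ball_lt_top

/-- Lower bound for the `L²(λ)` norm when the function is large on a small ball. -/
lemma lower_small (n : ℕ) {r : ℝ} (hr : r ≤ 1 / 2) (F : En n → ℝ≥0∞) (hF : Measurable F) (A : ℝ≥0∞)
    (hA : ∀ z ∈ ball (0 : En n) r, A ≤ F z) :
    ENNReal.ofReal (2 ^ (-|(-(n : ℝ) - 1)|)) * volume (ball (0 : En n) r) * A ^ 2 ≤
      ∫⁻ z, (F z) ^ 2 ∂(lambdaM n) := by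
  rw [lint_lambda _ (hF.pow_const 2)]
  calc _ = ∫⁻ z in ball (0 : En n) r, ENNReal.ofReal (2 ^ (-|(-(n : ℝ) - 1)|)) * A ^ 2 := by
        rw [setLIntegral_const]; ring
    _ ≤ ∫⁻ z in ball (0 : En n) r, om n z * F z ^ 2 := by
        apply setLIntegral_mono' measurableSet_ball
        intro z hz
        gcongr
        · exact (om_small (by linarith [mem_ball_zero_iff.1 hz])).1
        · exact hA z hz
    _ ≤ _ := lintegral_mono_set (smallball_subset hr)

lemma E_bounds {n : ℕ} {z w : En n} (h : ‖z‖ * ‖w‖ ≤ 1 / 2) :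
    1 / 2 ≤ ‖1 - herm z w‖ ∧ ‖1 - herm z w‖ ≤ 2 := by
  have h1 := norm_sub_norm_le (1 : ℂ) (herm z w)
  have h3 := norm_sub_le (1 : ℂ) (herm z w)
  rw [norm_one] at h1 h3
  have h2 := norm_herm_le z w
  exact ⟨by linarith, by linarith⟩

theorem Tabc_necessary_c {n : ℕ} (hn : 1 ≤ n) (a b c : ℝ) (C : ℝ)
    (hC : ∀ h : En n → ℝ≥0∞, Measurable h →
          (∫⁻ z, (Tabc a b c h z) ^ 2 ∂(lambdaM n)) ≤
            ENNReal.ofReal (C ^ 2) * ∫⁻ z, (h z) ^ 2 ∂(lambdaM n)) : -2 * (n : ℝ) < c := by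
  by_contra hc
  push Not at hc
  have hn' : (1 : ℝ) ≤ n := by exact_mod_cast hn
  have hc0 : c < 0 := by linarith
  set h : En n → ℝ≥0∞ := (ball (0 : En n) (1 / 2)).indicator (fun _ => (1 : ℝ≥0∞)) with hh
  have hhm : Measurable h := measurable_const.indicator measurableSet_ball
  set K : ℝ := 2 ^ (-|a|) * 2 ^ (-|b|) * 2 ^ (-|-((n : ℝ) + 1 + a + b + c)|) with hK
  have hK0 : 0 < K := by positivity
  have hT : ∀ z ∈ ball (0 : En n) (1 / 4), (⊤ : ℝ≥0∞) ≤ Tabc a b c h z := by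
    intro z hz
    have hz' := mem_ball_zero_iff.1 hz
    have hz1 : z ∈ ball (0 : En n) 1 := smallball_subset (by norm_num) hz
    have hsub : ball z (1 / 4) ⊆ ball (0 : En n) 1 := by
      intro w hw
      rw [mem_ball_zero_iff]
      have h1 := mem_ball_iff_norm.1 hw
      have h2 := norm_le_norm_add_norm_sub' w z
      linarith
    calc (⊤ : ℝ≥0∞) = ENNReal.ofReal K * ∫⁻ w in ball (0 : En n) (1 / 4), ENNReal.ofReal (‖w‖ ^ c) := by
          rw [lint_norm_top hn (by norm_num) hc, ENNReal.mul_top]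
          rw [Ne, ENNReal.ofReal_eq_zero, not_le]; exact hK0
      _ = ENNReal.ofReal K * ∫⁻ w in ball z (1 / 4), ENNReal.ofReal (‖w - z‖ ^ c) := by
          congr 1
          have := (measurePreserving_sub_right (volume : Measure (En n)) z).setLIntegral_comp_emb
            (MeasurableEquiv.subRight z).measurableEmbedding (fun w => ENNReal.ofReal (‖w‖ ^ c)) (ball z (1 / 4))
          rw [this]
          congr 2
          ext w
          simp only [mem_image, mem_ball_iff_norm]
          constructor
          · intro hw
            exact ⟨w + z, by simpa using hw, by simp⟩
          · rintro ⟨u, hu, rfl⟩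
            simpa using hu
      _ = ∫⁻ w in ball z (1 / 4), ENNReal.ofReal K * ENNReal.ofReal (‖w - z‖ ^ c) := by
          rw [lintegral_const_mul' _ _ ENNReal.ofReal_ne_top]
      _ ≤ ∫⁻ w in ball z (1 / 4), ENNReal.ofReal (ker n a b c z w) * h w := by
          apply setLIntegral_mono' measurableSet_ball
          intro w hw
          have h1 := mem_ball_iff_norm.1 hw
          have h2 := norm_le_norm_add_norm_sub' w z
          have hw2 : ‖w‖ < 1 / 2 := by linarith
          rw [hh, indicator_of_mem (mem_ball_zero_iff.2 hw2), mul_one, ← ENNReal.ofReal_mul hK0.le]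
          apply ENNReal.ofReal_le_ofReal
          have hE := E_bounds (z := z) (w := w) (by nlinarith [norm_nonneg z, norm_nonneg w])
          have b1 := rpow_ge_of_mem a (v := 1 - ‖z‖ ^ 2) (by nlinarith [norm_nonneg z]) (by nlinarith [norm_nonneg z])
          have b2 := rpow_ge_of_mem b (v := 1 - ‖w‖ ^ 2) (by nlinarith [norm_nonneg w]) (by nlinarith [norm_nonneg w])
          have b3 := rpow_ge_of_mem (-((n : ℝ) + 1 + a + b + c)) hE.1 hE.2
          have b4 : ‖w - z‖ ^ c ≤ Real.sqrt (trid w z) ^ c := by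
            by_cases hwz : w = z
            · subst hwz
              have : trid w w = 0 := by rw [trid_formula]; simp [herm]
              simp [this, hc0.ne]
            have hpos : 0 < ‖w - z‖ := norm_pos_iff.2 (sub_ne_zero.2 hwz)
            have hx := one_sub_pos hz1
            apply Real.rpow_le_rpow_of_nonpos _ _ hc0.le
            · apply Real.sqrt_pos.2
              rw [trid_formula]
              positivity
            · apply Real.sqrt_le_iff.2 ⟨norm_nonneg _, ?_⟩
              rw [trid_formula]
              have h5 := norm_herm_le (w - z) z
              have h6 : ‖herm (w - z) z‖ ^ 2 ≤ (‖w - z‖ * ‖z‖) ^ 2 := by gcongr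
              nlinarith
          have hx := one_sub_pos hz1
          have hw1 : w ∈ ball (0 : En n) 1 := hsub hw
          have hy := one_sub_pos hw1
          calc K * ‖w - z‖ ^ c = 2 ^ (-|a|) * 2 ^ (-|b|) * ‖w - z‖ ^ c * 2 ^ (-|-((n : ℝ) + 1 + a + b + c)|) := by
                rw [hK]; ring
            _ ≤ ker n a b c z w := by
                unfold ker
                gcongr
      _ ≤ Tabc a b c h z := by
          rw [Tabc_eq]
          exact lintegral_mono_set hsub
  have h1 := lower_small n (by norm_num) (Tabc a b c h) (measurable_Tabc a b c h hhm) ⊤ hT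
  have h2 := h1.trans (hC h hhm)
  have h3 : ENNReal.ofReal (C ^ 2) * ∫⁻ z, (h z) ^ 2 ∂(lambdaM n) < ⊤ :=
    ENNReal.mul_lt_top ENNReal.ofReal_lt_top (ind_finite n (by norm_num))
  have h4 : ENNReal.ofReal (2 ^ (-|(-(n : ℝ) - 1)|)) * volume (ball (0 : En n) (1 / 4)) ≠ 0 := by
    apply mul_ne_zero
    · rw [Ne, ENNReal.ofReal_eq_zero, not_le]; positivity
    · exact (measure_ball_pos _ _ (by norm_num)).ne'
  rw [ENNReal.top_pow two_ne_zero, ENNReal.mul_top h4] at h2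
  exact absurd h3 (not_lt.2 h2)

/-- Kernel lower bound when one variable is near the origin and the other near the sphere. -/
lemma mixed_bounds {n : ℕ} {u v : En n} (hu : u ∈ ball (0 : En n) (1 / 8)) (hv : v ∈ ann n) :
    (1 / 2 ≤ 1 - ‖u‖ ^ 2 ∧ 1 - ‖u‖ ^ 2 ≤ 2) ∧ (1 / 2 ≤ ‖1 - herm u v‖ ∧ ‖1 - herm u v‖ ≤ 2) ∧
      (1 / 2 ≤ Real.sqrt (trid v u) ∧ Real.sqrt (trid v u) ≤ 2) := by
  have hu' := mem_ball_zero_iff.1 hu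
  obtain ⟨hv1, hv2⟩ := hv
  have h0 := norm_nonneg u
  have hp : ‖u‖ * ‖v‖ ≤ 1 / 8 := by nlinarith
  have hE := E_bounds (z := u) (w := v) (by linarith)
  refine ⟨⟨by nlinarith, by nlinarith⟩, hE, ?_, ?_⟩
  · apply Real.le_sqrt_of_sq_le
    rw [trid, norm_one_sub_herm_comm v u]
    have h1 := norm_sub_norm_le (1 : ℂ) (herm u v)
    rw [norm_one] at h1
    have h2 := norm_herm_le u v
    have h3 : 7 / 8 ≤ ‖1 - herm u v‖ := by linarith
    have h4 : (1 - ‖v‖ ^ 2) ≤ 7 / 16 := by nlinarith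
    have h5 : 0 ≤ (1 - ‖v‖ ^ 2) := by nlinarith
    nlinarith
  · exact (sqrt_trid_le (smallball_subset (by norm_num) hu) (mem_ball_zero_iff.2 hv2)).trans hE.2

theorem Tabc_necessary_a {n : ℕ} (hn : 1 ≤ n) (a b c : ℝ) (C : ℝ)
    (hC : ∀ h : En n → ℝ≥0∞, Measurable h →
          (∫⁻ z, (Tabc a b c h z) ^ 2 ∂(lambdaM n)) ≤
            ENNReal.ofReal (C ^ 2) * ∫⁻ z, (h z) ^ 2 ∂(lambdaM n)) : -2 * a < -(n : ℝ) := by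
  by_contra ha
  push Not at ha
  set h : En n → ℝ≥0∞ := (ball (0 : En n) (1 / 8)).indicator (fun _ => (1 : ℝ≥0∞)) with hh
  have hhm : Measurable h := measurable_const.indicator measurableSet_ball
  set K : ℝ := 2 ^ (-|b|) * 2 ^ (-|c|) * 2 ^ (-|-((n : ℝ) + 1 + a + b + c)|) with hK
  have hK0 : 0 < K := by positivity
  set v := volume (ball (0 : En n) (1 / 8)) with hv
  have hv0 : v ≠ 0 := (measure_ball_pos _ _ (by norm_num)).ne'
  have hT : ∀ z ∈ ann n, ENNReal.ofReal (K * (1 - ‖z‖ ^ 2) ^ a) * v ≤ Tabc a b c h z := by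
    intro z hz
    calc _ = ∫⁻ w in ball (0 : En n) (1 / 8), ENNReal.ofReal (K * (1 - ‖z‖ ^ 2) ^ a) := by
          rw [setLIntegral_const]
      _ ≤ ∫⁻ w in ball (0 : En n) (1 / 8), ENNReal.ofReal (ker n a b c z w) * h w := by
          apply setLIntegral_mono' measurableSet_ball
          intro w hw
          rw [hh, indicator_of_mem hw, mul_one]
          apply ENNReal.ofReal_le_ofReal
          obtain ⟨m1, m2, m3⟩ := mixed_bounds hw hz
          rw [trid_comm] at m3
          rw [norm_one_sub_herm_comm] at m2
          have b1 := rpow_ge_of_mem b m1.1 m1.2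
          have b2 := rpow_ge_of_mem c m3.1 m3.2
          have b3 := rpow_ge_of_mem (-((n : ℝ) + 1 + a + b + c)) m2.1 m2.2
          have hx := one_sub_pos (ann_subset n hz)
          have hy := one_sub_pos (smallball_subset (by norm_num) hw)
          calc _ = (1 - ‖z‖ ^ 2) ^ a * 2 ^ (-|b|) * 2 ^ (-|c|) * 2 ^ (-|-((n : ℝ) + 1 + a + b + c)|) := by
                rw [hK]; ring
            _ ≤ _ := by
                unfold ker
                gcongr
      _ ≤ _ := by
          rw [Tabc_eq]
          exact lintegral_mono_set (smallball_subset (by norm_num))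
  have h3 : ENNReal.ofReal (C ^ 2) * ∫⁻ z, (h z) ^ 2 ∂(lambdaM n) < ⊤ :=
    ENNReal.mul_lt_top ENNReal.ofReal_lt_top (ind_finite n (by norm_num))
  have h4 : (⊤ : ℝ≥0∞) ≤ ∫⁻ z, (Tabc a b c h z) ^ 2 ∂(lambdaM n) := by
    rw [lint_lambda _ ((measurable_Tabc a b c h hhm).pow_const 2)]
    calc (⊤ : ℝ≥0∞) = (ENNReal.ofReal (K ^ 2) * v ^ 2) * ∫⁻ z in ann n, ENNReal.ofReal ((1 - ‖z‖ ^ 2) ^ (2 * a - n - 1)) := by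
          rw [lint_ann_top hn (by linarith), ENNReal.mul_top]
          apply mul_ne_zero
          · rw [Ne, ENNReal.ofReal_eq_zero, not_le]; positivity
          · exact pow_ne_zero _ hv0
      _ = ∫⁻ z in ann n, (ENNReal.ofReal (K ^ 2) * v ^ 2) * ENNReal.ofReal ((1 - ‖z‖ ^ 2) ^ (2 * a - n - 1)) := by
          rw [lintegral_const_mul _ (by fun_prop)]
      _ ≤ ∫⁻ z in ann n, om n z * (Tabc a b c h z) ^ 2 := by
          apply setLIntegral_mono' (measurableSet_ann n)
          intro z hz
          have hx := one_sub_pos (ann_subset n hz)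
          calc _ = om n z * (ENNReal.ofReal (K * (1 - ‖z‖ ^ 2) ^ a) * v) ^ 2 := by
                have e1 : (1 - ‖z‖ ^ 2) ^ (2 * a - n - 1) = (1 - ‖z‖ ^ 2) ^ (-(n : ℝ) - 1) * ((1 - ‖z‖ ^ 2) ^ a) ^ 2 := by
                  rw [pow_two ((1 - ‖z‖ ^ 2) ^ a), ← Real.rpow_add hx, ← Real.rpow_add hx]; congr 1; ring
                rw [e1, om, ENNReal.ofReal_mul (by positivity), ENNReal.ofReal_mul (by positivity),
                  ENNReal.ofReal_pow (by positivity), ENNReal.ofReal_pow (by positivity)]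
                ring
            _ ≤ _ := by
                gcongr
                exact hT z hz
      _ ≤ _ := lintegral_mono_set (ann_subset n)
  exact absurd h3 (not_lt.2 (h4.trans (hC h hhm)))

theorem Tabc_necessary_b {n : ℕ} (hn : 1 ≤ n) (a b c : ℝ) (C : ℝ)
    (hC : ∀ h : En n → ℝ≥0∞, Measurable h →
          (∫⁻ z, (Tabc a b c h z) ^ 2 ∂(lambdaM n)) ≤
            ENNReal.ofReal (C ^ 2) * ∫⁻ z, (h z) ^ 2 ∂(lambdaM n)) : -(n : ℝ) < 2 * (b + 1) := by
  by_contra hb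
  push Not at hb
  set K : ℝ := 2 ^ (-|a|) * 2 ^ (-|c|) * 2 ^ (-|-((n : ℝ) + 1 + a + b + c)|) with hK
  have hK0 : 0 < K := by positivity
  set q : ℝ := 2 * b + n + 1 with hq
  set A : ℕ → Set (En n) := fun j => ann n ∩ {w | (1 - ‖w‖ ^ 2) ^ q ≤ j} with hA
  have hAm : ∀ j, MeasurableSet (A j) := fun j =>
    (measurableSet_ann n).inter (measurableSet_le (by fun_prop) measurable_const)
  have hAs : ∀ j, A j ⊆ ann n := fun j => inter_subset_left
  set M : ℕ → ℝ≥0∞ := fun j => ∫⁻ w in A j, ENNReal.ofReal ((1 - ‖w‖ ^ 2) ^ q) with hM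
  have hMfin : ∀ j, M j ≠ ⊤ := by
    intro j
    have : M j ≤ ∫⁻ w in A j, ENNReal.ofReal (j : ℝ) := by
      apply setLIntegral_mono' (hAm j)
      intro w hw
      exact ENNReal.ofReal_le_ofReal hw.2
    refine (this.trans_lt ?_).ne
    rw [setLIntegral_const]
    refine ENNReal.mul_lt_top ENNReal.ofReal_lt_top ?_
    exact (measure_mono ((hAs j).trans (ann_subset n))).trans_lt measure_ball_lt_top
  set B := ENNReal.ofReal (2 ^ (-|(-(n : ℝ) - 1)|)) * volume (ball (0 : En n) (1 / 8)) with hB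
  have hB0 : B ≠ 0 := by
    apply mul_ne_zero
    · rw [Ne, ENNReal.ofReal_eq_zero, not_le]; positivity
    · exact (measure_ball_pos _ _ (by norm_num)).ne'
  have hkey : ∀ j, B * ENNReal.ofReal (K ^ 2) * M j ≤ ENNReal.ofReal (C ^ 2) := by
    intro j
    by_cases hM0 : M j = 0
    · rw [hM0, mul_zero]; exact zero_le
    set h : En n → ℝ≥0∞ := (A j).indicator (fun w => ENNReal.ofReal ((1 - ‖w‖ ^ 2) ^ (b + n + 1))) with hh
    have hhm : Measurable h := Measurable.indicator (by fun_prop) (hAm j)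
    have hT : ∀ z ∈ ball (0 : En n) (1 / 8), ENNReal.ofReal K * M j ≤ Tabc a b c h z := by
      intro z hz
      calc _ = ∫⁻ w in A j, ENNReal.ofReal K * ENNReal.ofReal ((1 - ‖w‖ ^ 2) ^ q) := by
            rw [lintegral_const_mul _ (by fun_prop)]
        _ ≤ ∫⁻ w in A j, ENNReal.ofReal (ker n a b c z w) * h w := by
            apply setLIntegral_mono' (hAm j)
            intro w hw
            obtain ⟨m1, m2, m3⟩ := mixed_bounds hz (hAs j hw)
            have b1 := rpow_ge_of_mem a m1.1 m1.2
            have b2 := rpow_ge_of_mem c m3.1 m3.2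
            have b3 := rpow_ge_of_mem (-((n : ℝ) + 1 + a + b + c)) m2.1 m2.2
            have hx := one_sub_pos (smallball_subset (by norm_num) hz)
            have hy := one_sub_pos (ann_subset n (hAs j hw))
            rw [hh, indicator_of_mem hw, ← ENNReal.ofReal_mul (by positivity),
              ← ENNReal.ofReal_mul (by unfold ker; positivity)]
            apply ENNReal.ofReal_le_ofReal
            have e1 : (1 - ‖w‖ ^ 2) ^ q = (1 - ‖w‖ ^ 2) ^ b * (1 - ‖w‖ ^ 2) ^ (b + n + 1) := by
              rw [← Real.rpow_add hy]; congr 1; rw [hq]; ring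
            rw [e1, ← mul_assoc]
            gcongr
            calc _ = 2 ^ (-|a|) * (1 - ‖w‖ ^ 2) ^ b * 2 ^ (-|c|) * 2 ^ (-|-((n : ℝ) + 1 + a + b + c)|) := by
                  rw [hK]; ring
              _ ≤ _ := by
                  unfold ker
                  gcongr
        _ ≤ _ := by
            rw [Tabc_eq]
            exact lintegral_mono_set ((hAs j).trans (ann_subset n))
    have h1 := lower_small n (by norm_num) (Tabc a b c h) (measurable_Tabc a b c h hhm) _ hT
    have h2 : ∫⁻ z, (h z) ^ 2 ∂(lambdaM n) = M j := by
      rw [lint_lambda _ (hhm.pow_const 2)]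
      have e1 : ∀ z ∈ ball (0 : En n) 1, om n z * h z ^ 2 =
          (A j).indicator (fun w => ENNReal.ofReal ((1 - ‖w‖ ^ 2) ^ q)) z := by
        intro z hz
        have hx := one_sub_pos hz
        by_cases hzA : z ∈ A j
        · rw [hh, indicator_of_mem hzA, indicator_of_mem hzA, om, ← ENNReal.ofReal_pow (by positivity),
            ← ENNReal.ofReal_mul (by positivity)]
          congr 1
          rw [pow_two ((1 - ‖z‖ ^ 2) ^ (b + n + 1)), ← Real.rpow_add hx, ← Real.rpow_add hx]
          congr 1
          rw [hq]; ring
        · rw [hh, indicator_of_notMem hzA, indicator_of_notMem hzA]; simp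
      rw [setLIntegral_congr_fun measurableSet_ball e1, setLIntegral_indicator (hAm j),
        inter_eq_left.2 ((hAs j).trans (ann_subset n))]
    have h3 := h1.trans (hC h hhm)
    rw [h2, ← hB, mul_pow, ← ENNReal.ofReal_pow hK0.le] at h3
    have h4 : (B * ENNReal.ofReal (K ^ 2) * M j) * M j ≤ ENNReal.ofReal (C ^ 2) * M j := by
      calc _ = B * (ENNReal.ofReal (K ^ 2) * M j ^ 2) := by ring
        _ ≤ _ := h3
    exact (ENNReal.mul_le_mul_iff_left hM0 (hMfin j)).1 h4
  have hsup : (⨆ j, M j) = ⊤ := by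
    have hmono : Monotone A := by
      intro i j hij w hw
      have h2 : (1 - ‖w‖ ^ 2) ^ q ≤ (i : ℝ) := hw.2
      have h3 : (1 - ‖w‖ ^ 2) ^ q ≤ (j : ℝ) := h2.trans (by exact_mod_cast hij)
      exact ⟨hw.1, h3⟩
    rw [hM, ← setLIntegral_iUnion_of_directed _ hmono.directed_le]
    have : ⋃ j, A j = ann n := by
      apply Subset.antisymm (iUnion_subset hAs)
      intro w hw
      obtain ⟨j, hj⟩ := exists_nat_ge ((1 - ‖w‖ ^ 2) ^ q)
      exact mem_iUnion.2 ⟨j, hw, hj⟩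
    rw [this]
    exact lint_ann_top hn (by rw [hq]; linarith)
  have hle : B * ENNReal.ofReal (K ^ 2) * (⨆ j, M j) ≤ ENNReal.ofReal (C ^ 2) := by
    rw [ENNReal.mul_iSup]
    exact iSup_le hkey
  rw [hsup, ENNReal.mul_top] at hle
  · exact absurd ENNReal.ofReal_lt_top (not_lt.2 hle)
  · apply mul_ne_zero hB0
    rw [Ne, ENNReal.ofReal_eq_zero, not_le]; positivity


/-- `T_{a,b,c}` is bounded on `L²(λ_n)` if and only if `c > -2n` and `-2a < -n < 2(b+1)`. -/
theorem Tabc_bounded_on_L2_iff (n : ℕ) (hn : 1 ≤ n) (a b c : ℝ) :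
    (∃ C : ℝ,
        ∀ h : En n → ℝ≥0∞, Measurable h →
          (∫⁻ z, (Tabc a b c h z) ^ 2 ∂(lambdaM n)) ≤
            ENNReal.ofReal (C ^ 2) * ∫⁻ z, (h z) ^ 2 ∂(lambdaM n)) ↔
      (-2 * (n : ℝ) < c ∧ -2 * a < -(n : ℝ) ∧ -(n : ℝ) < 2 * (b + 1)) := by
  constructor
  · rintro ⟨C, hC⟩
    exact ⟨Tabc_necessary_c hn a b c C hC, Tabc_necessary_a hn a b c C hC,
      Tabc_necessary_b hn a b c C hC⟩
  · rintro ⟨hc, ha, hb⟩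
    obtain ⟨m, rfl⟩ : ∃ m, n = m + 1 := ⟨n - 1, by omega⟩
    exact Tabc_sufficient m a b c hc ha hb
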